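/- Pieri rule in the fusion ring: for every λ ∈ P_c, every ω ∈ P⁺ that is minuscule or quasi-minuscule, and every node ξ ∈ 𝒫_c, one has χ_ω(ξ)χ_λ(ξ) = (N_{0,ω} − N_{λ,ω})χ_λ(ξ) + ∑_{ν∈W₀ω, λ+ν∈P_c} χ_{λ+ν}(ξ), where N_{λ,ω} = |{j ∈ {0,1,…,n} : a_j(λ) = 0 and α_j ∈ W₀ω}|. In particular, N_{λ,ω} = 0 whenever ω is minuscule. -/

import Mathlib

noncomputable section

open scoped RealInnerProductSpace BigOperators Classical
open Filter

namespace AffinePieri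

variable {V : Type*} [NormedAddCommGroup V] [InnerProductSpace ℝ V] [FiniteDimensional ℝ V]

/-- The coroot `α^∨ = 2α/⟨α,α⟩` of a vector `α`. -/
def coroot (α : V) : V := (2 / ⟪α, α⟫) • α

lemma refl_involutive (α : V) (k : ℝ) :
    Function.Involutive (fun x : V => x - (⟪x, coroot α⟫ + k) • α) := by
  intro x
  by_cases h : α = 0
  · simp [h, coroot]
  · have hαα : ⟪α, α⟫ ≠ 0 := fun hc => h (inner_self_eq_zero.mp hc)
    have h2 : ⟪α, coroot α⟫ = 2 := by
      rw [coroot, real_inner_smul_right]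
      field_simp
    show (x - (⟪x, coroot α⟫ + k) • α) -
        (⟪x - (⟪x, coroot α⟫ + k) • α, coroot α⟫ + k) • α = x
    rw [inner_sub_left, real_inner_smul_left, h2]
    have key : (⟪x, coroot α⟫ + k) +
        (⟪x, coroot α⟫ - (⟪x, coroot α⟫ + k) * 2 + k) = 0 := by ring
    rw [sub_sub, ← add_smul, key, zero_smul, sub_zero]

/-- The (affine) orthogonal reflection `x ↦ x - (⟨x,α^∨⟩ + k)α` as a permutation of `V`. -/
def reflP (α : V) (k : ℝ) : Equiv.Perm V :=
  Function.Involutive.toPerm _ (refl_involutive α k)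

@[simp] lemma reflP_apply (α : V) (k : ℝ) (x : V) :
    reflP α k x = x - (⟪x, coroot α⟫ + k) • α := rfl

/-- The sign of a real number, as an integer. -/
def zsgn (v : ℝ) : ℤ := if 0 < v then 1 else if v < 0 then -1 else 0

/-- Alternating composition `f ∘ g ∘ f ∘ ⋯` with `m` factors, used for braid relations. -/
def altOp {A : Type*} (f g : A → A) : ℕ → A → A
  | 0 => id
  | (k + 1) => f ∘ altOp g f k

/-- The interaction potential `v_α` entering the Morse (fusion) potential, for a
parameter family `s`. -/
def vintOf (s : V → ℝ) (α : V) (x : ℝ) : ℝ :=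
  (1 - s α ^ 2) * ∫ y in (0:ℝ)..x, 1 / (1 - 2 * s α * Real.cos y + s α ^ 2)

/-- All the standing data of the paper: an irreducible reduced crystallographic root
system `R₀` spanning the Euclidean space `V`, with a positive system, simple roots,
highest (short) roots, an admissible pair `(R₀, R̂₀)` encoded by the map `hat` and the
affine root `α₀`, a `W₀`-invariant multiplicity function `t` with values in `(-1,1)`,
and an integral level `c > 1`. -/
structure Setup (V : Type*) [NormedAddCommGroup V] [InnerProductSpace ℝ V]
    [FiniteDimensional ℝ V] where
  n : ℕ
  npos : 0 < n
  hdim : Module.finrank ℝ V = n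
  R0 : Finset V
  zero_not_mem : (0 : V) ∉ R0
  span_top : Submodule.span ℝ (R0 : Set V) = ⊤
  cryst : ∀ α ∈ R0, ∀ β ∈ R0, ∃ k : ℤ, ⟪β, coroot α⟫ = (k : ℝ)
  refl_mem : ∀ α ∈ R0, ∀ β ∈ R0, β - ⟪β, coroot α⟫ • α ∈ R0
  reduced : ∀ α ∈ R0, ∀ r : ℝ, r • α ∈ R0 → r = 1 ∨ r = -1
  irred : ¬ ∃ A B : Set V, A.Nonempty ∧ B.Nonempty ∧ A ∪ B = (R0 : Set V) ∧
      ∀ α ∈ A, ∀ β ∈ B, ⟪α, β⟫ = 0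
  Rpos : Finset V
  pos_subset : Rpos ⊆ R0
  pos_partition : ∀ α ∈ R0, (α ∈ Rpos ↔ -α ∉ Rpos)
  simple : Fin n → V
  simple_mem : ∀ j, simple j ∈ Rpos
  pos_decomp : ∀ α ∈ Rpos, ∃ f : Fin n → ℕ, α = ∑ j, (f j : ℝ) • simple j
  hroot : V
  hroot_mem : hroot ∈ Rpos
  hroot_highest : ∀ β ∈ R0, ∃ f : Fin n → ℕ, hroot - β = ∑ j, (f j : ℝ) • simple j
  hs : V
  hs_mem : hs ∈ Rpos
  hs_short : ∀ α ∈ R0, ⟪hs, hs⟫ ≤ ⟪α, α⟫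
  hs_highest : ∀ β ∈ R0, ⟪β, β⟫ = ⟪hs, hs⟫ →
      ∃ f : Fin n → ℕ, hs - β = ∑ j, (f j : ℝ) • simple j
  hat : V → V
  a0 : V
  admissible : ((∀ α : V, hat α = coroot α) ∧ a0 = -hs) ∨
      ((∀ α : V, hat α = (2 / ⟪hroot, hroot⟫) • α) ∧ a0 = -hroot)
  t : V → ℝ
  t_bound : ∀ α ∈ R0, |t α| < 1
  t_invariant : ∀ α ∈ R0, ∀ β ∈ R0, t (β - ⟪β, coroot α⟫ • α) = t β
  c : ℤ
  c_gt : 1 < c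

namespace Setup

variable (S : Setup V)

/-- `m_α = 2/⟨α, α̂⟩`. -/
def m (α : V) : ℝ := 2 / ⟪α, S.hat α⟫

/-- The finite Weyl group `W₀`, generated by the reflections in the roots. -/
def W0 : Subgroup (Equiv.Perm V) :=
  Subgroup.closure {w | ∃ α ∈ S.R0, w = reflP α 0}

/-- The affine Weyl group `W`, generated by the affine reflections
`s_a` for `a = α^∨ + m_α r c`. -/
def W : Subgroup (Equiv.Perm V) :=
  Subgroup.closure {w | ∃ α ∈ S.R0, ∃ r : ℤ, w = reflP α (S.m α * (r : ℝ) * (S.c : ℝ))}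

/-- The `W₀`-orbit of a vector. -/
def orb (ω : V) : Set V := {x | ∃ w ∈ S.W0, w ω = x}

/-- The weight lattice `P` of `R₀`. -/
def Plat : Set V := {x | ∀ α ∈ S.R0, ∃ k : ℤ, ⟪x, coroot α⟫ = (k : ℝ)}

/-- The root lattice `Q` of `R₀`. -/
def Qlat : Set V := (AddSubgroup.closure (S.R0 : Set V) : Set V)

/-- The semigroup `Q⁺` generated by the positive roots. -/
def Qplus : Set V := (AddSubmonoid.closure (S.Rpos : Set V) : Set V)

/-- The cone `P⁺` of dominant weights. -/
def Pplus : Set V := {x | x ∈ S.Plat ∧ ∀ α ∈ S.Rpos, 0 ≤ ⟪x, coroot α⟫}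

/-- The dominant affine alcove `A_c = {x | 0 ≤ ⟨x,β⟩ ≤ c ∀ β ∈ R̂₀⁺}`. -/
def Alc : Set V := {x | ∀ α ∈ S.Rpos, 0 ≤ ⟪x, S.hat α⟫ ∧ ⟪x, S.hat α⟫ ≤ (S.c : ℝ)}

/-- `P_c = P ∩ A_c`. -/
def Pc : Set V := {x | x ∈ S.Plat ∧ x ∈ S.Alc}

/-- The weight lattice `P̂` of `R̂₀`. -/
def Phat : Set V := {x | ∀ α ∈ S.R0, ∃ k : ℤ, ⟪x, coroot (S.hat α)⟫ = (k : ℝ)}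

/-- `P̂_c = {μ ∈ P̂ | 0 ≤ ⟨μ,α⟩ ≤ c ∀ α ∈ R₀⁺}`. -/
def Phatc : Set V :=
  {x | x ∈ S.Phat ∧ ∀ α ∈ S.Rpos, 0 ≤ ⟪x, α⟫ ∧ ⟪x, α⟫ ≤ (S.c : ℝ)}

/-- The half sum `ρ` of the positive roots of `R₀`. -/
def rho : V := (2⁻¹ : ℝ) • ∑ α ∈ S.Rpos, α

/-- The half sum `ρ̂` of the positive roots of `R̂₀`. -/
def rhoHat : V := (2⁻¹ : ℝ) • ∑ α ∈ S.Rpos, S.hat α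

/-- The coroot lattice `Q̂^∨` of `R̂₀`. -/
def Qhatvee : Set V :=
  (AddSubgroup.closure ((fun α => coroot (S.hat α)) '' (S.R0 : Set V)) : Set V)

/-- The gradient (direction) of the affine simple root `a_j`:
`α₀` for `j = 0` and `α_j` otherwise. -/
def alpha (j : Fin (S.n + 1)) : V :=
  if h : (j : ℕ) = 0 then S.a0 else S.simple ⟨(j : ℕ) - 1, by have := j.isLt; omega⟩

/-- The constant term of the affine simple root `a_j`. -/
def kconst (j : Fin (S.n + 1)) : ℝ := if (j : ℕ) = 0 then (S.c : ℝ) else 0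

/-- The affine simple root `a_j` as an affine function on `V`. -/
def aFun (j : Fin (S.n + 1)) (x : V) : ℝ := ⟪x, coroot (S.alpha j)⟫ + S.kconst j

/-- The simple affine reflections `s_0, s_1, …, s_n`. -/
def sgen (j : Fin (S.n + 1)) : Equiv.Perm V := reflP (S.alpha j) (S.kconst j)

/-- The length of an element of the affine Weyl group: the minimal length of an
expression as a product of the simple reflections. -/
def len (w : Equiv.Perm V) : ℕ :=
  sInf {k | ∃ l : List (Fin (S.n + 1)), l.length = k ∧ (l.map S.sgen).prod = w}

/-- The length of an element of the finite Weyl group w.r.t. the simple reflections. -/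
def len0 (w : Equiv.Perm V) : ℕ :=
  sInf {k | ∃ l : List (Fin S.n), l.length = k ∧
    (l.map fun j => reflP (S.simple j) 0).prod = w}

/-- `l` is a reduced expression for `w`. -/
def IsReducedWord (l : List (Fin (S.n + 1))) (w : Equiv.Perm V) : Prop :=
  (l.map S.sgen).prod = w ∧ l.length = S.len w

/-- The Bruhat partial order on the affine Weyl group. -/
def BruhatLE (v w : Equiv.Perm V) : Prop :=
  ∃ l : List (Fin (S.n + 1)), S.IsReducedWord l w ∧
    ∃ l' : List (Fin (S.n + 1)), l'.Sublist l ∧ (l'.map S.sgen).prod = v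

/-- Evaluation of a function on the weight lattice at a point of `V` (by `0` off `P`). -/
def ev (f : ↥S.Plat → ℂ) (x : V) : ℂ := if h : x ∈ S.Plat then f ⟨x, h⟩ else 0

/-- The integral part `J_j` of the integral-reflection operators. -/
def Jop (j : Fin (S.n + 1)) (f : ↥S.Plat → ℂ) (x : ↥S.Plat) : ℂ :=
  if 0 < Int.floor (S.aFun j x.1) then
    -∑ k ∈ Finset.Icc (1 : ℤ) (Int.floor (S.aFun j x.1)),
      S.ev f (x.1 - (k : ℝ) • S.alpha j)
  else if Int.floor (S.aFun j x.1) < 0 then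
    ∑ k ∈ Finset.Icc (0 : ℤ) (-(Int.floor (S.aFun j x.1)) - 1),
      S.ev f (x.1 + (k : ℝ) • S.alpha j)
  else 0

/-- The integral-reflection operators `T_j = t_j s_j + (t_j - 1) J_j` on `𝒞(P)`. -/
def Top (j : Fin (S.n + 1)) (f : ↥S.Plat → ℂ) (x : ↥S.Plat) : ℂ :=
  (S.t (S.alpha j) : ℂ) * S.ev f ((S.sgen j)⁻¹ x.1) +
    ((S.t (S.alpha j) : ℂ) - 1) * S.Jop j f x

/-- The operator `T_{j₁} ∘ ⋯ ∘ T_{j_ℓ}` attached to a word `l = [j₁, …, j_ℓ]`. -/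
def wordOp (l : List (Fin (S.n + 1))) : (↥S.Plat → ℂ) → (↥S.Plat → ℂ) :=
  l.foldr (fun j g => S.Top j ∘ g) id

/-- `TW` realizes `w ↦ T_w` (via reduced expressions). -/
def IsTW (TW : Equiv.Perm V → (↥S.Plat → ℂ) → (↥S.Plat → ℂ)) : Prop :=
  ∀ w l, S.IsReducedWord l w → TW w = S.wordOp l

/-- `tw` realizes the length multiplicative function `w ↦ t_w` (via reduced expressions). -/
def IsTmult (tw : Equiv.Perm V → ℂ) : Prop :=
  ∀ w l, S.IsReducedWord l w → tw w = (l.map fun j => (S.t (S.alpha j) : ℂ)).prod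

/-- `wmin` realizes `x ↦ w_x`, the unique shortest affine Weyl group element moving `x`
into the dominant alcove. -/
def IsShortest (wmin : V → Equiv.Perm V) : Prop :=
  ∀ x : V, wmin x ∈ S.W ∧ wmin x x ∈ S.Alc ∧
    ∀ w ∈ S.W, w x ∈ S.Alc →
      S.len (wmin x) ≤ S.len w ∧ (S.len w = S.len (wmin x) → w = wmin x)

/-- The positive affine roots, encoded as pairs `(α, r)` representing `α^∨ + m_α r c`. -/
def RplusP : Set (V × ℤ) :=
  {p | p.1 ∈ S.R0 ∧ (1 ≤ p.2 ∨ (p.2 = 0 ∧ p.1 ∈ S.Rpos))}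

/-- The value of the affine root encoded by `p = (α, r)` at a point of `V`. -/
def affval (p : V × ℤ) (x : V) : ℝ :=
  ⟪x, coroot p.1⟫ + S.m p.1 * (p.2 : ℝ) * (S.c : ℝ)

/-- `R[λ] = {a ∈ R⁺ | a(λ) < 0}`. -/
def Raff (lam : V) : Set (V × ℤ) := {p | p ∈ S.RplusP ∧ S.affval p lam < 0}

/-- `t[λ] = ∏_{a ∈ R[λ]} t_{a'}`. -/
def tBr (lam : V) : ℂ := ∏ᶠ p ∈ S.Raff lam, (S.t p.1 : ℂ)

/-- `θ(λ) = |{a ∈ R⁺ | a(λ) = -2}|`. -/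
def thetaCt (lam : V) : ℕ :=
  Set.ncard {p : V × ℤ | p ∈ S.RplusP ∧ S.affval p lam = -2}

/-- The affine intertwining operator `𝒥`, defined via `wmin` and `TW`. -/
def JJ (wmin : V → Equiv.Perm V) (TW : Equiv.Perm V → (↥S.Plat → ℂ) → (↥S.Plat → ℂ))
    (f : ↥S.Plat → ℂ) (x : ↥S.Plat) : ℂ :=
  (S.tBr x.1)⁻¹ * S.ev (TW (wmin x.1) f) (wmin x.1 x.1)

/-- The Morse (fusion-potential) function `𝒱_μ` for a parameter family `s`. -/
def MorseOf (s : V → ℝ) (μ ξ : V) : ℝ :=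
  ((S.c : ℝ) / 2) * ⟪ξ, ξ⟫ - 2 * Real.pi * ⟪S.rhoHat + μ, ξ⟫ +
    ∑ α ∈ S.Rpos, (2 / ⟪α, coroot (S.hat α)⟫) * ∫ x in (0:ℝ)..(⟪ξ, α⟫), vintOf s α x

/-- The Morse function `𝒱_μ` for the multiplicity function of the setup. -/
def Morse (μ ξ : V) : ℝ := S.MorseOf S.t μ ξ

/-- The critical equation `cξ + ∑_{α∈R₀⁺} v_α(⟨ξ,α⟩) α̂ = 2π(ρ̂ + μ)`. -/
def CritEq (μ x : V) : Prop :=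
  (S.c : ℝ) • x + ∑ α ∈ S.Rpos, (vintOf S.t α ⟪x, α⟫) • S.hat α =
    (2 * Real.pi) • (S.rhoHat + μ)

/-- Extension of a parameter vector indexed by `R₀` to a function on `V` (by zero). -/
def extParam (s : ↥S.R0 → ℝ) : V → ℝ := fun α => if h : α ∈ S.R0 then s ⟨α, h⟩ else 0

/-- `xi` realizes `μ ↦ ξ_μ`, the unique global minimizer of `𝒱_μ`. -/
def IsMinimizer (xi : V → V) : Prop :=
  ∀ μ ∈ S.Phat, ∀ x : V, x ≠ xi μ → S.Morse μ (xi μ) < S.Morse μ x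

/-- The `c`-function of the Macdonald spherical function. -/
def Cfun (ξ : V) : ℂ :=
  ∏ α ∈ S.Rpos, (1 - (S.t α : ℂ) * Complex.exp (-(Complex.I * (⟪ξ, α⟫ : ℂ)))) /
      (1 - Complex.exp (-(Complex.I * (⟪ξ, α⟫ : ℂ))))

/-- The Macdonald spherical function `M_λ(ξ)`. -/
def Msph (lam ξ : V) : ℂ :=
  ∑ᶠ w ∈ (S.W0 : Set (Equiv.Perm V)),
    S.Cfun (w ξ) * Complex.exp (Complex.I * (⟪w ξ, lam⟫ : ℂ))

/-- The orbit sum `m_ω(e^{iξ})`. -/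
def mSym (ω ξ : V) : ℂ := ∑ᶠ ν ∈ S.orb ω, Complex.exp (Complex.I * (⟪ν, ξ⟫ : ℂ))

/-- The plane wave `e^{iξ} ∈ 𝒞(P)`. -/
def planewave (ξ : V) : ↥S.Plat → ℂ :=
  fun lam => Complex.exp (Complex.I * (⟪lam.1, ξ⟫ : ℂ))

/-- The free operator `L_{ω;1}`. -/
def Lfree (ω : V) (f : ↥S.Plat → ℂ) (x : ↥S.Plat) : ℂ :=
  ∑ᶠ ν ∈ S.orb ω, S.ev f (x.1 + ν)

/-- `φ_ξ = ∑_{v ∈ W₀} T_v e^{iξ}`. -/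
def phiW (TW : Equiv.Perm V → (↥S.Plat → ℂ) → (↥S.Plat → ℂ)) (ξ : V) : ↥S.Plat → ℂ :=
  ∑ᶠ w ∈ (S.W0 : Set (Equiv.Perm V)), TW w (S.planewave ξ)

/-- The affine Macdonald spherical function `Φ_ξ = 𝒥 φ_ξ`. -/
def PhiA (wmin : V → Equiv.Perm V)
    (TW : Equiv.Perm V → (↥S.Plat → ℂ) → (↥S.Plat → ℂ)) (ξ : V) : ↥S.Plat → ℂ :=
  S.JJ wmin TW (S.phiW TW ξ)

/-- Invariance of a lattice function under the affine Weyl group. -/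
def Winv (f : ↥S.Plat → ℂ) : Prop :=
  ∀ w ∈ S.W, ∀ x : ↥S.Plat, S.ev f (w⁻¹ x.1) = f x

/-- A minuscule dominant weight. -/
def Minuscule (ω : V) : Prop := ω ∈ S.Pplus ∧ ∀ α ∈ S.Rpos, ⟪ω, coroot α⟫ ≤ 1

/-- `P_ϑ^⋆`: the orbit of the minuscule and quasi-minuscule weights. -/
def Pstar : Set V :=
  {x | ∃ w ∈ S.W0, ∃ η : V, (S.Minuscule η ∨ η = S.hs) ∧ x = w η}

/-- `ê_t(η) = ∏_{β∈R̂₀⁺} t_β^{⟨η,β^∨⟩/2}`. -/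
def et (η : V) : ℂ :=
  ∏ α ∈ S.Rpos, (S.t α : ℂ) ^ (((⟪η, coroot (S.hat α)⟫ / 2 : ℝ) : ℂ))

/-- `ĥ_t = t_{α₀} ê_t(-α₀^∨)`. -/
def hhat : ℂ := (S.t S.a0 : ℂ) * S.et (-(coroot S.a0))

/-- `e_t(ν) = ∏_{α∈R₀⁺} t_α^{⟨ν,α^∨⟩/2}`. -/
def elit (ν : V) : ℂ :=
  ∏ α ∈ S.Rpos, (S.t α : ℂ) ^ (((⟪ν, coroot α⟫ / 2 : ℝ) : ℂ))

/-- `h_t = t_ϑ e_t(-α₀)`. -/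
def hlit : ℂ := (S.t S.hs : ℂ) * S.elit (-S.a0)

/-- The coefficients `d_{λ,ν}`. -/
def dcoef (lam ν : V) : ℂ :=
  if ν ∈ S.orb S.hs then
    (S.thetaCt (lam + ν) : ℂ) * S.elit (-ν) * S.hlit ^ zsgn ⟪lam, S.hat ν⟫
  else 0

/-- The Pieri coefficients `V_{λ,ν}(t)`. -/
def Vcoef (lam ν : V) : ℂ :=
  (∏ α ∈ S.Rpos, if ⟪lam, S.hat α⟫ = 0 ∧ 0 < ⟪ν, S.hat α⟫ then
      (1 - (S.t α : ℂ) * S.et (S.hat α)) / (1 - S.et (S.hat α)) else 1) *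
  ∏ α ∈ S.Rpos, if ⟪lam, S.hat α⟫ = (S.c : ℝ) ∧ ⟪ν, S.hat α⟫ < 0 then
      (1 - (S.t α : ℂ) * S.hhat * S.et (-(S.hat α))) / (1 - S.hhat * S.et (-(S.hat α)))
    else 1

/-- The Pieri coefficients `U_{λ,ω}(t)`. -/
def Ucoef (wmin : V → Equiv.Perm V) (lam ω : V) : ℂ :=
  (∑ᶠ ν ∈ {ν | ν ∈ S.orb ω ∧ wmin (lam + ν) (lam + ν) = lam}, S.tBr (lam + ν)) +
    (1 - (S.t S.hs : ℂ)⁻¹) *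
      ∑ᶠ ν ∈ {ν | ν ∈ S.orb ω ∧ wmin (lam + ν) lam = lam}, S.dcoef lam ν

/-- The linear part of an affine transformation of `V`. -/
def linp (w : Equiv.Perm V) (x : V) : V := w x - w (0 : V)

/-- The set `[x] = {y | y₊ = x₊, w_y ≤ w_x}`. -/
def bra (wmin : V → Equiv.Perm V) (x : V) : Set V :=
  {y | wmin y y = wmin x x ∧ S.BruhatLE (wmin y) (wmin x)}

/-- The partial order `μ ⪯ λ`. -/
def preceq (wmin : V → Equiv.Perm V) (μ lam : V) : Prop :=
  lam - μ ∈ S.Qlat ∧ convexHull ℝ (S.bra wmin μ) ⊆ convexHull ℝ (S.bra wmin lam)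

/-- The Weyl denominator `δ(ξ)`. -/
def weylDenom (ξ : V) : ℂ :=
  ∏ α ∈ S.Rpos, (Complex.exp (Complex.I * (⟪ξ, α⟫ : ℂ) / 2) -
      Complex.exp (-(Complex.I * (⟪ξ, α⟫ : ℂ) / 2)))

/-- The Weyl character `χ_λ(ξ)`. -/
def chiW (lam ξ : V) : ℂ :=
  (S.weylDenom ξ)⁻¹ * ∑ᶠ w ∈ (S.W0 : Set (Equiv.Perm V)),
    ((-1 : ℂ) ^ S.len0 w) * Complex.exp (Complex.I * (⟪w ξ, lam + S.rho⟫ : ℂ))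

/-- The counting function `N_{λ,ω}`. -/
def Ncount (lam ω : V) : ℕ :=
  Nat.card {j : Fin (S.n + 1) // S.aFun j lam = 0 ∧ S.alpha j ∈ S.orb ω}

end Setup



/-! ### Reflections -/

lemma inner_coroot (x α : V) : ⟪x, coroot α⟫ = 2 * ⟪x, α⟫ / ⟪α, α⟫ := by
  rw [coroot, real_inner_smul_right]; ring

lemma inner_self_pos' {α : V} (h : α ≠ 0) : 0 < ⟪α, α⟫ := real_inner_self_pos.mpr h

lemma inner_self_coroot {α : V} (h : α ≠ 0) : ⟪α, coroot α⟫ = 2 := by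
  have := inner_self_pos' h
  rw [inner_coroot]; field_simp

lemma coroot_pos_iff {α : V} (h : α ≠ 0) (x : V) : 0 < ⟪x, coroot α⟫ ↔ 0 < ⟪x, α⟫ := by
  have := inner_self_pos' h
  rw [inner_coroot, div_pos_iff_of_pos_right this]
  constructor <;> intro h <;> linarith

lemma coroot_nonneg_iff {α : V} (h : α ≠ 0) (x : V) : 0 ≤ ⟪x, coroot α⟫ ↔ 0 ≤ ⟪x, α⟫ := by
  have := inner_self_pos' h
  rw [inner_coroot, div_nonneg_iff]
  constructor
  · rintro (h | h) <;> linarith [h.1]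
  · intro h; left; constructor <;> linarith

lemma coroot_zero_iff {α : V} (h : α ≠ 0) (x : V) : ⟪x, coroot α⟫ = 0 ↔ ⟪x, α⟫ = 0 := by
  have := inner_self_pos' h
  rw [inner_coroot, div_eq_zero_iff]
  constructor
  · rintro (h | h) <;> linarith
  · intro h; left; rw [h]; ring

lemma coroot_neg (α : V) : coroot (-α) = -coroot α := by
  simp [coroot]

lemma coroot_coroot {α : V} (h : α ≠ 0) : coroot (coroot α) = α := by
  have := inner_self_pos' h
  rw [coroot, coroot, real_inner_smul_left, real_inner_smul_right, smul_smul]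
  have : 2 / (2 / ⟪α, α⟫ * (2 / ⟪α, α⟫ * ⟪α, α⟫)) * (2 / ⟪α, α⟫) = 1 := by
    field_simp
  rw [this, one_smul]

lemma reflP_zero_apply (α x : V) : reflP α 0 x = x - ⟪x, coroot α⟫ • α := by
  rw [reflP_apply, add_zero]

lemma reflP_mul_self (α : V) (k : ℝ) : reflP α k * reflP α k = 1 := by
  ext x
  exact refl_involutive α k x

lemma reflP_refl (α x : V) : reflP α 0 (reflP α 0 x) = x := refl_involutive α 0 x

lemma reflP_inv (α : V) (k : ℝ) : (reflP α k)⁻¹ = reflP α k :=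
  inv_eq_of_mul_eq_one_right (reflP_mul_self α k)

lemma reflP_neg_root (α : V) : reflP (-α) 0 = reflP α 0 := by
  ext x
  simp [reflP_zero_apply, coroot_neg]

lemma reflP_self {α : V} (h : α ≠ 0) : reflP α 0 α = -α := by
  rw [reflP_zero_apply, inner_self_coroot h, two_smul]; abel

lemma reflP_add (α x y : V) : reflP α 0 (x + y) = reflP α 0 x + reflP α 0 y := by
  simp only [reflP_zero_apply, inner_add_left, add_smul]; abel

lemma reflP_smul (α : V) (r : ℝ) (x : V) : reflP α 0 (r • x) = r • reflP α 0 x := by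
  simp only [reflP_zero_apply, real_inner_smul_left, smul_sub, mul_smul]

lemma reflP_inner (α x y : V) : ⟪reflP α 0 x, reflP α 0 y⟫ = ⟪x, y⟫ := by
  by_cases h : α = 0
  · simp [h, reflP_zero_apply]
  have := inner_self_pos' h
  simp only [reflP_zero_apply, inner_sub_left, inner_sub_right, real_inner_smul_left,
    real_inner_smul_right, inner_coroot, real_inner_comm α]
  rw [real_inner_comm y α]
  field_simp
  ring

/-- The reflection as a linear map. -/
def reflL (α : V) : V →ₗ[ℝ] V where
  toFun := reflP α 0
  map_add' := reflP_add α
  map_smul' := reflP_smul α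

lemma reflL_apply (α x : V) : reflL α x = reflP α 0 x := rfl

lemma det_reflL {α : V} (h : α ≠ 0) : LinearMap.det (reflL α) = -1 := by
  have hpos := inner_self_pos' h
  have e : reflL α = ((Submodule.span ℝ {α})ᗮ.reflection).toLinearMap := by
    ext x
    have h1 := Submodule.reflection_orthogonal_apply (K := Submodule.span ℝ {α}) x
    rw [reflL_apply, reflP_zero_apply]
    show _ = (Submodule.span ℝ {α})ᗮ.reflection x
    rw [h1, Submodule.reflection_singleton_apply]
    have h2 : ‖α‖ ^ 2 = ⟪α, α⟫ := (real_inner_self_eq_norm_sq α).symm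
    simp only [inner_coroot, two_smul, RCLike.ofReal_real_eq_id, id]
    rw [h2, real_inner_comm x α, neg_sub, ← add_smul]
    congr 2
    ring
  rw [e, Submodule.det_reflection, Submodule.orthogonal_orthogonal, finrank_span_singleton h]
  norm_num

/-- The group element as linear map, determinant of. -/
def detP (w : Equiv.Perm V) : ℝ :=
  if h : ∃ g : V →ₗ[ℝ] V, ∀ x, g x = w x then LinearMap.det h.choose else 0

lemma detP_eq {w : Equiv.Perm V} {g : V →ₗ[ℝ] V} (hg : ∀ x, g x = w x) :
    detP w = LinearMap.det g := by
  have h : ∃ g : V →ₗ[ℝ] V, ∀ x, g x = w x := ⟨g, hg⟩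
  rw [detP, dif_pos h]
  congr 1
  ext x
  rw [hg, h.choose_spec]

lemma detP_one : detP (1 : Equiv.Perm V) = 1 := by
  rw [detP_eq (g := LinearMap.id) (by intro x; rfl), LinearMap.det_id]

lemma detP_reflP {α : V} (h : α ≠ 0) : detP (reflP α 0) = -1 := by
  rw [detP_eq (g := reflL α) (fun x => rfl), det_reflL h]

lemma detP_mul {w v : Equiv.Perm V} (hw : ∃ g : V →ₗ[ℝ] V, ∀ x, g x = w x)
    (hv : ∃ g : V →ₗ[ℝ] V, ∀ x, g x = v x) : detP (w * v) = detP w * detP v := by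
  obtain ⟨g, hg⟩ := hw
  obtain ⟨k, hk⟩ := hv
  rw [detP_eq hg, detP_eq hk, detP_eq (g := g ∘ₗ k) (by intro x; simp [hg, hk]),
    LinearMap.det_comp]

namespace Setup
variable (S : Setup V)

/-! ### Roots, positive roots, simple roots -/

lemma ne_zero {α : V} (h : α ∈ S.R0) : α ≠ 0 := fun h0 => S.zero_not_mem (h0 ▸ h)

lemma pos_R0 {α : V} (h : α ∈ S.Rpos) : α ∈ S.R0 := S.pos_subset h

lemma simple_R0 (j : Fin S.n) : S.simple j ∈ S.R0 := S.pos_R0 (S.simple_mem j)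

lemma simple_ne (j : Fin S.n) : S.simple j ≠ 0 := S.ne_zero (S.simple_R0 j)

lemma reflP_mem {α β : V} (hα : α ∈ S.R0) (hβ : β ∈ S.R0) : reflP α 0 β ∈ S.R0 := by
  rw [reflP_zero_apply]; exact S.refl_mem α hα β hβ

lemma neg_mem {α : V} (h : α ∈ S.R0) : -α ∈ S.R0 := by
  have := S.reflP_mem h h
  rwa [reflP_self (S.ne_zero h)] at this

lemma pos_or_neg {α : V} (h : α ∈ S.R0) : α ∈ S.Rpos ∨ -α ∈ S.Rpos := by
  by_cases h1 : -α ∈ S.Rpos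
  · exact Or.inr h1
  · exact Or.inl ((S.pos_partition α h).2 h1)

lemma neg_not_pos {α : V} (h : α ∈ S.Rpos) : -α ∉ S.Rpos :=
  (S.pos_partition α (S.pos_R0 h)).1 h

lemma neg_pos_of_not {α : V} (h : α ∈ S.R0) (h' : α ∉ S.Rpos) : -α ∈ S.Rpos :=
  (S.pos_or_neg h).resolve_left h'

lemma span_simple : ⊤ ≤ Submodule.span ℝ (Set.range S.simple) := by
  rw [← S.span_top, Submodule.span_le]
  have key : ∀ α ∈ S.Rpos, α ∈ Submodule.span ℝ (Set.range S.simple) := by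
    intro α hα
    obtain ⟨f, rfl⟩ := S.pos_decomp α hα
    exact Submodule.sum_mem _ fun j _ => Submodule.smul_mem _ _ (Submodule.subset_span ⟨j, rfl⟩)
  intro α hα
  rcases S.pos_or_neg hα with h | h
  · exact key α h
  · have := Submodule.neg_mem _ (key _ h)
    rwa [neg_neg] at this

lemma simple_li : LinearIndependent ℝ S.simple :=
  linearIndependent_of_top_le_span_of_card_eq_finrank S.span_simple (by rw [S.hdim]; simp)

/-- The basis of simple roots. -/
def bas : Module.Basis (Fin S.n) ℝ V := Module.Basis.mk S.simple_li S.span_simple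

lemma bas_apply (j : Fin S.n) : S.bas j = S.simple j := by simp [bas]

/-- Coefficient of the simple root `α_j`. -/
def co (j : Fin S.n) : V →ₗ[ℝ] ℝ := S.bas.coord j

lemma co_simple (i j : Fin S.n) : S.co i (S.simple j) = if i = j then 1 else 0 := by
  rw [co, ← S.bas_apply, Module.Basis.coord_apply, Module.Basis.repr_self, Finsupp.single_apply]
  simp [eq_comm]

lemma co_sum (f : Fin S.n → ℝ) (i : Fin S.n) : S.co i (∑ j, f j • S.simple j) = f i := by
  simp [map_sum, co_simple]

lemma sum_co (x : V) : ∑ j, S.co j x • S.simple j = x := by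
  have := S.bas.sum_repr x
  simpa [bas_apply, co] using this

lemma ext_co {x y : V} (h : ∀ j, S.co j x = S.co j y) : x = y := by
  rw [← S.sum_co x, ← S.sum_co y]; simp [h]

lemma inner_eq_sum (x y : V) : ⟪x, y⟫ = ∑ j, S.co j y * ⟪x, S.simple j⟫ := by
  conv_lhs => rw [← S.sum_co y]
  rw [inner_sum]; simp [real_inner_smul_right]

lemma co_nat {α : V} (h : α ∈ S.Rpos) (j : Fin S.n) : ∃ k : ℕ, S.co j α = k := by
  obtain ⟨f, rfl⟩ := S.pos_decomp α h
  exact ⟨f j, S.co_sum _ j⟩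

lemma co_nonneg {α : V} (h : α ∈ S.Rpos) (j : Fin S.n) : 0 ≤ S.co j α := by
  obtain ⟨k, hk⟩ := S.co_nat h j
  rw [hk]; positivity

lemma simple_inj : Function.Injective S.simple := S.simple_li.injective

/-- a positive root which is not simple has two simple roots in its support -/
lemma exists_other {β : V} (h : β ∈ S.Rpos) (j : Fin S.n) (hne : β ≠ S.simple j) :
    ∃ i, i ≠ j ∧ 0 < S.co i β := by
  by_contra! hc
  have h0 : ∀ i, i ≠ j → S.co i β = 0 := fun i hi => le_antisymm (hc i hi) (S.co_nonneg h i)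
  have e : β = S.co j β • S.simple j := by
    apply S.ext_co
    intro i
    rw [map_smul, co_simple]
    by_cases hi : i = j
    · simp [hi]
    · simp [hi, h0 i hi]
  have h1 := S.reduced _ (S.simple_R0 j) (S.co j β) (e ▸ S.pos_R0 h)
  rcases h1 with h1 | h1
  · rw [h1, one_smul] at e; exact hne e
  · have := S.co_nonneg h j; linarith

lemma refl_simple_pos {β : V} (h : β ∈ S.Rpos) (j : Fin S.n) (hne : β ≠ S.simple j) :
    reflP (S.simple j) 0 β ∈ S.Rpos := by
  obtain ⟨i, hi, hpos⟩ := S.exists_other h j hne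
  by_contra hc
  have h1 := S.neg_pos_of_not (S.reflP_mem (S.simple_R0 j) (S.pos_R0 h)) hc
  have h2 := S.co_nonneg h1 i
  rw [reflP_zero_apply, map_neg, map_sub, map_smul, co_simple, if_neg hi] at h2
  simp at h2; linarith

lemma refl_simple_ne {β : V} (h : β ∈ S.Rpos) (j : Fin S.n) :
    reflP (S.simple j) 0 β ≠ S.simple j := by
  intro hc
  have h1 := congrArg (reflP (S.simple j) 0) hc
  rw [reflP_refl, reflP_self (S.simple_ne j)] at h1
  exact S.neg_not_pos (S.simple_mem j) (h1 ▸ h)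

/-- Dominance. -/
def Dom (x : V) : Prop := ∀ j, 0 ≤ ⟪x, S.simple j⟫

variable {S} in
lemma Dom.pos {x : V} (h : S.Dom x) {α : V} (hα : α ∈ S.Rpos) : 0 ≤ ⟪x, α⟫ := by
  rw [S.inner_eq_sum]
  exact Finset.sum_nonneg fun j _ => mul_nonneg (S.co_nonneg hα j) (h j)

lemma exists_simple_pos {β : V} (h : β ∈ S.Rpos) : ∃ j, 0 < ⟪β, S.simple j⟫ ∧ 0 < S.co j β := by
  by_contra! hc
  have h1 := inner_self_pos' (S.ne_zero (S.pos_R0 h))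
  rw [S.inner_eq_sum] at h1
  have : ∑ j, S.co j β * ⟪β, S.simple j⟫ ≤ 0 := by
    apply Finset.sum_nonpos
    intro j _
    rcases (S.co_nonneg h j).lt_or_eq with h2 | h2
    · by_contra hh
      push Not at hh
      have : 0 < ⟪β, S.simple j⟫ := by
        by_contra h3
        push Not at h3
        nlinarith
      linarith [hc j this]
    · rw [← h2, zero_mul]
  linarith

/-- Induction over the positive roots. -/
lemma pos_induction {p : V → Prop} (hs : ∀ j, p (S.simple j))
    (hr : ∀ β ∈ S.Rpos, ∀ j, p β → p (reflP (S.simple j) 0 β)) :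
    ∀ β ∈ S.Rpos, p β := by
  have key : ∀ N : ℕ, ∀ β ∈ S.Rpos, ∑ j, S.co j β < N → p β := by
    intro N
    induction N with
    | zero =>
      intro β hβ h
      have : 0 ≤ ∑ j, S.co j β := Finset.sum_nonneg fun j _ => S.co_nonneg hβ j
      simp at h; linarith
    | succ N ih =>
      intro β hβ h
      obtain ⟨j, hj, -⟩ := S.exists_simple_pos hβ
      by_cases hne : β = S.simple j
      · rw [hne]; exact hs j
      have h1 := S.refl_simple_pos hβ j hne
      have h2 : ∑ i, S.co i (reflP (S.simple j) 0 β) < N := by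
        have e : ∑ i, S.co i (reflP (S.simple j) 0 β)
            = ∑ i, S.co i β - ⟪β, coroot (S.simple j)⟫ := by
          simp [reflP_zero_apply, co_simple, Finset.sum_sub_distrib]
        obtain ⟨k, hk⟩ := S.cryst _ (S.simple_R0 j) _ (S.pos_R0 hβ)
        have h3 := (coroot_pos_iff (S.simple_ne j) β).2 hj
        rw [hk] at h3
        have h4 : (1:ℝ) ≤ k := by exact_mod_cast h3
        rw [e, hk]; push_cast at h; linarith
      have h3 := hr _ h1 j (ih _ h1 h2)
      rwa [reflP_refl] at h3
  intro β hβ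
  obtain ⟨N, hN⟩ := exists_nat_gt (∑ j, S.co j β)
  exact key N β hβ hN

/-! ### rho -/

lemma sum_refl_simple {M : Type*} [AddCommMonoid M] (F : V → M) (j : Fin S.n) :
    ∑ α ∈ S.Rpos.erase (S.simple j), F (reflP (S.simple j) 0 α)
      = ∑ α ∈ S.Rpos.erase (S.simple j), F α := by
  have hm : ∀ a ∈ S.Rpos.erase (S.simple j),
      reflP (S.simple j) 0 a ∈ S.Rpos.erase (S.simple j) := by
    intro a ha
    rw [Finset.mem_erase] at ha ⊢
    exact ⟨S.refl_simple_ne ha.2 j, S.refl_simple_pos ha.2 j ha.1⟩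
  exact Finset.sum_nbij' (reflP (S.simple j) 0) (reflP (S.simple j) 0) hm hm
    (fun a _ => reflP_refl _ _) (fun a _ => reflP_refl _ _) (fun a _ => rfl)

lemma reflL_rho (j : Fin S.n) : reflP (S.simple j) 0 S.rho = S.rho - S.simple j := by
  have h : S.rho = (2⁻¹ : ℝ) • S.simple j
      + (2⁻¹ : ℝ) • ∑ α ∈ S.Rpos.erase (S.simple j), α := by
    rw [rho, ← Finset.add_sum_erase _ _ (S.simple_mem j), smul_add]
  have h2 : reflP (S.simple j) 0 (∑ α ∈ S.Rpos.erase (S.simple j), α)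
      = ∑ α ∈ S.Rpos.erase (S.simple j), α := by
    rw [← reflL_apply, map_sum]
    exact S.sum_refl_simple (fun x => x) j
  conv_lhs => rw [h, reflP_add, reflP_smul, reflP_smul, reflP_self (S.simple_ne j), h2]
  rw [h]
  module

lemma rho_coroot (j : Fin S.n) : ⟪S.rho, coroot (S.simple j)⟫ = 1 := by
  have h := S.reflL_rho j
  rw [reflP_zero_apply] at h
  have h1 := congrArg (S.co j) h
  simp [co_simple] at h1
  exact h1

lemma rho_simple (j : Fin S.n) : 0 < ⟪S.rho, S.simple j⟫ := by
  rw [← coroot_pos_iff (S.simple_ne j), rho_coroot]; norm_num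

lemma rho_pos {α : V} (h : α ∈ S.Rpos) : 0 < ⟪S.rho, α⟫ := by
  obtain ⟨j, -, hj⟩ := S.exists_simple_pos h
  rw [S.inner_eq_sum]
  refine Finset.sum_pos' (fun i _ => mul_nonneg (S.co_nonneg h i) (S.rho_simple i).le)
    ⟨j, Finset.mem_univ _, mul_pos hj (S.rho_simple j)⟩

lemma rho_pos_iff {α : V} (h : α ∈ S.R0) : 0 < ⟪S.rho, α⟫ ↔ α ∈ S.Rpos := by
  refine ⟨fun h1 => ?_, S.rho_pos⟩
  by_contra hc
  have := S.rho_pos (S.neg_pos_of_not h hc)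
  rw [inner_neg_right] at this; linarith

lemma coroot_refl_simple (v β : V) (j : Fin S.n) :
    ⟪v, coroot (reflP (S.simple j) 0 β)⟫
      = ⟪v, coroot β⟫ - ⟪S.simple j, coroot β⟫ * ⟪v, coroot (S.simple j)⟫ := by
  have h := inner_self_pos' (S.simple_ne j)
  rw [inner_coroot, inner_coroot _ β, inner_coroot _ β, reflP_inner, reflP_zero_apply,
    inner_sub_right, real_inner_smul_right, inner_coroot, inner_coroot,
    real_inner_comm β (S.simple j)]
  ring

/-- integrality can be tested on the simple coroots -/
lemma int_of_simple {v : V} (h : ∀ j, ∃ k : ℤ, ⟪v, coroot (S.simple j)⟫ = k) :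
    v ∈ S.Plat := by
  have key : ∀ β ∈ S.Rpos, (β ∈ S.R0 ∧ ∃ k : ℤ, ⟪v, coroot β⟫ = k) := by
    refine S.pos_induction (p := fun β => β ∈ S.R0 ∧ ∃ k : ℤ, ⟪v, coroot β⟫ = k) ?_ ?_
    · exact fun j => ⟨S.simple_R0 j, h j⟩
    · rintro β - j ⟨hβ, k, hk⟩
      refine ⟨S.reflP_mem (S.simple_R0 j) hβ, ?_⟩
      obtain ⟨l, hl⟩ := h j
      obtain ⟨m, hm⟩ := S.cryst _ hβ _ (S.simple_R0 j)
      refine ⟨k - m * l, ?_⟩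
      rw [coroot_refl_simple, hk, hl, hm]; push_cast; ring
  intro α hα
  rcases S.pos_or_neg hα with h1 | h1
  · exact (key α h1).2
  · obtain ⟨-, k, hk⟩ := key _ h1
    rw [coroot_neg, inner_neg_right] at hk
    exact ⟨-k, by push_cast; linarith⟩

lemma rho_Plat : S.rho ∈ S.Plat := S.int_of_simple fun j => ⟨1, by rw [rho_coroot]; norm_num⟩

end Setup

namespace Setup
variable (S : Setup V)

/-! ### The Weyl group -/

lemma refl_W0 {α : V} (h : α ∈ S.R0) : reflP α 0 ∈ S.W0 :=
  Subgroup.subset_closure ⟨α, h, rfl⟩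

lemma W0_all {w : Equiv.Perm V} (h : w ∈ S.W0) :
    (∃ g : V →ₗ[ℝ] V, ∀ x, g x = w x) ∧ (∀ x y, ⟪w x, w y⟫ = ⟪x, y⟫) ∧
    (∀ α ∈ S.R0, w α ∈ S.R0) ∧ (∀ α ∈ S.R0, w⁻¹ α ∈ S.R0) := by
  induction h using Subgroup.closure_induction with
  | mem w hw =>
    obtain ⟨α, hα, rfl⟩ := hw
    refine ⟨⟨reflL α, fun x => rfl⟩, reflP_inner α, fun β hβ => S.reflP_mem hα hβ, ?_⟩
    rw [reflP_inv]
    exact fun β hβ => S.reflP_mem hα hβ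
  | one => exact ⟨⟨LinearMap.id, fun x => rfl⟩, fun _ _ => rfl, fun _ h => h, fun _ h => h⟩
  | mul x y _ _ hx hy =>
    obtain ⟨⟨g, hg⟩, hx2, hx3, hx4⟩ := hx
    obtain ⟨⟨k, hk⟩, hy2, hy3, hy4⟩ := hy
    refine ⟨⟨g ∘ₗ k, fun v => by simp [hg, hk]⟩, fun u v => ?_, fun α hα => hx3 _ (hy3 _ hα), ?_⟩
    · rw [Equiv.Perm.mul_apply, Equiv.Perm.mul_apply, hx2, hy2]
    · intro α hα
      rw [mul_inv_rev]
      exact hy4 _ (hx4 _ hα)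
  | inv x _ hx =>
    obtain ⟨⟨g, hg⟩, hx2, hx3, hx4⟩ := hx
    refine ⟨⟨⟨⟨fun v => x⁻¹ v, fun u v => ?_⟩, fun r v => ?_⟩, fun v => rfl⟩, fun u v => ?_, hx4, ?_⟩
    · apply x.injective
      have e := map_add g (x⁻¹ u) (x⁻¹ v)
      simp only [hg] at e
      rw [e]; simp
    · apply x.injective
      simp only [RingHom.id_apply]
      have e := map_smul g r (x⁻¹ v)
      simp only [hg] at e
      rw [e]; simp
    · rw [← hx2]; simp
    · rw [inv_inv]; exact hx3

variable {S} in
lemma W0_lin {w : Equiv.Perm V} (h : w ∈ S.W0) : ∃ g : V →ₗ[ℝ] V, ∀ x, g x = w x := (S.W0_all h).1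

variable {S} in
lemma W0_inner {w : Equiv.Perm V} (h : w ∈ S.W0) (x y : V) : ⟪w x, w y⟫ = ⟪x, y⟫ :=
  (S.W0_all h).2.1 x y

variable {S} in
lemma W0_mem {w : Equiv.Perm V} (h : w ∈ S.W0) {α : V} (hα : α ∈ S.R0) : w α ∈ S.R0 :=
  (S.W0_all h).2.2.1 α hα

variable {S} in
lemma W0_inner' {w : Equiv.Perm V} (h : w ∈ S.W0) (x y : V) : ⟪w x, y⟫ = ⟪x, w⁻¹ y⟫ := by
  rw [← W0_inner h x]; simp

variable {S} in
lemma W0_add {w : Equiv.Perm V} (h : w ∈ S.W0) (x y : V) : w (x + y) = w x + w y := by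
  obtain ⟨g, hg⟩ := W0_lin h
  rw [← hg, map_add, hg, hg]

variable {S} in
lemma W0_neg {w : Equiv.Perm V} (h : w ∈ S.W0) (x : V) : w (-x) = -w x := by
  obtain ⟨g, hg⟩ := W0_lin h
  rw [← hg, map_neg, hg]

variable {S} in
lemma W0_sub {w : Equiv.Perm V} (h : w ∈ S.W0) (x y : V) : w (x - y) = w x - w y := by
  obtain ⟨g, hg⟩ := W0_lin h
  rw [← hg, map_sub, hg, hg]

variable {S} in
lemma W0_smul {w : Equiv.Perm V} (h : w ∈ S.W0) (r : ℝ) (x : V) : w (r • x) = r • w x := by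
  obtain ⟨g, hg⟩ := W0_lin h
  rw [← hg, map_smul, hg]

variable {S} in
lemma W0_coroot {w : Equiv.Perm V} (h : w ∈ S.W0) (α : V) : coroot (w α) = w (coroot α) := by
  rw [coroot, coroot, W0_inner h, W0_smul h]

variable {S} in
lemma W0_refl {w : Equiv.Perm V} (h : w ∈ S.W0) (α : V) :
    reflP (w α) 0 = w * reflP α 0 * w⁻¹ := by
  ext x
  simp only [Equiv.Perm.mul_apply]
  rw [reflP_zero_apply, reflP_zero_apply, W0_sub h, W0_smul h, W0_coroot h,
    real_inner_comm, W0_inner' h, real_inner_comm]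
  simp

lemma W0_ext {w v : Equiv.Perm V} (hw : w ∈ S.W0) (hv : v ∈ S.W0)
    (h : ∀ α ∈ S.R0, w α = v α) : w = v := by
  obtain ⟨g, hg⟩ := W0_lin hw
  obtain ⟨k, hk⟩ := W0_lin hv
  have : g = k := by
    apply LinearMap.ext_on (s := (S.R0 : Set V)) S.span_top
    intro α hα
    rw [hg, hk, h α hα]
  ext x
  rw [← hg, ← hk, this]

lemma W0_finite : (S.W0 : Set (Equiv.Perm V)).Finite := by
  have : Finite S.W0 := by
    apply Finite.of_injective (β := S.R0 → S.R0)
      (fun w α => ⟨w.1 α.1, W0_mem w.2 α.2⟩)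
    intro w v h
    apply Subtype.ext
    apply S.W0_ext w.2 v.2
    intro α hα
    have := congrFun h ⟨α, hα⟩
    simpa using this
  exact Set.toFinite _

/-- `W₀` as a finset -/
def W0F : Finset (Equiv.Perm V) := S.W0_finite.toFinset

@[simp] lemma mem_W0F {w : Equiv.Perm V} : w ∈ S.W0F ↔ w ∈ S.W0 := by simp [W0F]

/-- product of a word -/
def wd (l : List (Fin S.n)) : Equiv.Perm V := (l.map fun j => reflP (S.simple j) 0).prod

@[simp] lemma wd_nil : S.wd [] = 1 := rfl

@[simp] lemma wd_cons (j : Fin S.n) (l : List (Fin S.n)) :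
    S.wd (j :: l) = reflP (S.simple j) 0 * S.wd l := by simp [wd]

lemma wd_append (l l' : List (Fin S.n)) : S.wd (l ++ l') = S.wd l * S.wd l' := by simp [wd]

lemma wd_mem (l : List (Fin S.n)) : S.wd l ∈ S.W0 := by
  induction l with
  | nil => exact one_mem _
  | cons j l ih => rw [wd_cons]; exact mul_mem (S.refl_W0 (S.simple_R0 j)) ih

lemma refl_wd {β : V} (h : β ∈ S.Rpos) : ∃ l, S.wd l = reflP β 0 := by
  refine S.pos_induction (p := fun β => ∃ l, S.wd l = reflP β 0) ?_ ?_ β h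
  · intro j; exact ⟨[j], by simp⟩
  · rintro β - j ⟨l, hl⟩
    refine ⟨[j] ++ l ++ [j], ?_⟩
    rw [wd_append, wd_append, hl, W0_refl (S.refl_W0 (S.simple_R0 j)), reflP_inv]
    simp

lemma exists_wd {w : Equiv.Perm V} (h : w ∈ S.W0) : ∃ l, S.wd l = w := by
  have key : ∀ w ∈ {w | ∃ α ∈ S.R0, w = reflP α 0}, ∃ l, S.wd l = w := by
    rintro w ⟨α, hα, rfl⟩
    rcases S.pos_or_neg hα with h | h
    · exact S.refl_wd h
    · rw [← reflP_neg_root]; exact S.refl_wd h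
  induction h using Subgroup.closure_induction with
  | mem w hw => exact key w hw
  | one => exact ⟨[], rfl⟩
  | mul x y _ _ hx hy =>
    obtain ⟨l, rfl⟩ := hx
    obtain ⟨l', rfl⟩ := hy
    exact ⟨l ++ l', S.wd_append l l'⟩
  | inv x _ hx =>
    obtain ⟨l, rfl⟩ := hx
    refine ⟨l.reverse, ?_⟩
    induction l with
    | nil => simp
    | cons j l ih => rw [List.reverse_cons, wd_append, ih (S.wd_mem l), S.wd_cons j l, mul_inv_rev, reflP_inv]; simp

lemma detP_W0_mul {w v : Equiv.Perm V} (hw : w ∈ S.W0) (hv : v ∈ S.W0) :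
    detP (w * v) = detP w * detP v := detP_mul (W0_lin hw) (W0_lin hv)

lemma detP_wd (l : List (Fin S.n)) : detP (S.wd l) = (-1) ^ l.length := by
  induction l with
  | nil => simp [detP_one]
  | cons j l ih =>
    rw [wd_cons, S.detP_W0_mul (S.refl_W0 (S.simple_R0 j)) (S.wd_mem l), ih,
      detP_reflP (S.simple_ne j), List.length_cons]
    ring

/-- a word of minimal length -/
lemma exists_min_wd {w : Equiv.Perm V} (h : w ∈ S.W0) :
    ∃ l, S.wd l = w ∧ l.length = S.len0 w ∧ ∀ l', S.wd l' = w → l.length ≤ l'.length := by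
  have hne : {k | ∃ l : List (Fin S.n), l.length = k ∧ S.wd l = w}.Nonempty := by
    obtain ⟨l, hl⟩ := S.exists_wd h
    exact ⟨_, l, rfl, hl⟩
  obtain ⟨l, hl, hw⟩ := Nat.sInf_mem hne
  refine ⟨l, hw, hl, fun l' hl' => ?_⟩
  rw [hl]
  exact Nat.sInf_le ⟨l', rfl, hl'⟩

lemma neg_one_len0 {w : Equiv.Perm V} (h : w ∈ S.W0) : (-1 : ℂ) ^ S.len0 w = (detP w : ℂ) := by
  obtain ⟨l, hl, hlen, -⟩ := S.exists_min_wd h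
  rw [← hlen]
  conv_rhs => rw [← hl, detP_wd]
  push_cast; rfl

/-- exchange -/
lemma exchange (l : List (Fin S.n)) : ∀ β ∈ S.Rpos, (S.wd l)⁻¹ β ∉ S.Rpos →
    ∃ l', l'.length + 1 = l.length ∧ reflP β 0 * S.wd l = S.wd l' := by
  induction l with
  | nil => intro β hβ h; simp [hβ] at h
  | cons i l ih =>
    intro β hβ h
    by_cases hb : β = S.simple i
    · refine ⟨l, by simp, ?_⟩
      rw [hb, wd_cons, ← mul_assoc, reflP_mul_self, one_mul]
    · rw [wd_cons, mul_inv_rev, Equiv.Perm.mul_apply, reflP_inv] at h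
      obtain ⟨l', hl, hw⟩ := ih _ (S.refl_simple_pos hβ i hb) h
      refine ⟨i :: l', by simpa using hl, ?_⟩
      rw [wd_cons, wd_cons, ← hw, W0_refl (S.refl_W0 (S.simple_R0 i)), reflP_inv]
      simp only [← mul_assoc, reflP_mul_self, one_mul]

/-- For a minimal word beginning with `i`. -/
lemma min_wd_neg {i : Fin S.n} {l : List (Fin S.n)}
    (hmin : ∀ l', S.wd l' = S.wd (i :: l) → (i :: l).length ≤ l'.length) :
    (S.wd (i :: l))⁻¹ (S.simple i) ∉ S.Rpos := by
  intro h
  have h1 : (S.wd l)⁻¹ (S.simple i) ∉ S.Rpos := by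
    rw [wd_cons, mul_inv_rev, Equiv.Perm.mul_apply, reflP_inv, reflP_self (S.simple_ne i),
      W0_neg (inv_mem (S.wd_mem l))] at h
    have := S.neg_not_pos h
    rwa [neg_neg] at this
  obtain ⟨l', hl, hw⟩ := S.exchange l _ (S.simple_mem i) h1
  have := hmin l' (by rw [← hw, wd_cons])
  simp at this; omega

lemma free {w : Equiv.Perm V} (h : w ∈ S.W0) (hfix : w S.rho = S.rho) : w = 1 := by
  obtain ⟨l, rfl, -, hmin⟩ := S.exists_min_wd h
  cases l with
  | nil => rfl
  | cons i l =>
    exfalso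
    apply S.min_wd_neg hmin
    rw [← S.rho_pos_iff (W0_mem (inv_mem h) (S.simple_R0 i)), ← W0_inner' h, hfix]
    exact S.rho_simple i

lemma dom_unique {x : V} (hx : S.Dom x) {w : Equiv.Perm V} (h : w ∈ S.W0) (hw : S.Dom (w x)) :
    w x = x := by
  have key : ∀ N : ℕ, ∀ w ∈ S.W0, S.len0 w < N → S.Dom (w x) → w x = x := by
    intro N
    induction N with
    | zero => intro w _ h; omega
    | succ N ih =>
      intro w h hN hw
      obtain ⟨l, rfl, hlen, hmin⟩ := S.exists_min_wd h
      cases l with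
      | nil => rfl
      | cons i l =>
        have h1 := S.min_wd_neg hmin
        have h2 := S.neg_pos_of_not (W0_mem (inv_mem h) (S.simple_R0 i)) h1
        have h3 := hx.pos h2
        rw [inner_neg_right, ← W0_inner' h] at h3
        have h4 : ⟪S.wd (i :: l) x, S.simple i⟫ = 0 := le_antisymm (by linarith) (hw i)
        have h5 : S.wd l x = S.wd (i :: l) x := by
          have h6 : reflP (S.simple i) 0 (S.wd (i :: l) x) = S.wd (i :: l) x := by
            rw [reflP_zero_apply, (coroot_zero_iff (S.simple_ne i) _).2 h4]; simp
          rw [← h6]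
          conv_rhs => rw [wd_cons, Equiv.Perm.mul_apply, reflP_refl]
        rw [← h5]
        apply ih _ (S.wd_mem l) _ (h5 ▸ hw)
        obtain ⟨l2, hl2, hlen2, hmin2⟩ := S.exists_min_wd (S.wd_mem l)
        have := hmin2 l rfl
        rw [List.length_cons] at hlen
        omega
  exact key _ w h (Nat.lt_succ_self _) hw

/-- conjugating into the dominant cone -/
lemma exists_dom {x : V} (hx : S.Dom x) (y : V) :
    ∃ w ∈ S.W0, S.Dom (w y) ∧ ⟪x, y⟫ ≤ ⟪x, w y⟫ := by
  obtain ⟨w, hw, hmax⟩ := Finset.exists_max_image (S.W0F.filter fun w => ⟪x, y⟫ ≤ ⟪x, w y⟫)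
    (fun w => ⟪S.rho, w y⟫) ⟨1, by simp [one_mem]⟩
  simp only [Finset.mem_filter, mem_W0F] at hw hmax
  refine ⟨w, hw.1, fun j => ?_, hw.2⟩
  by_contra hc
  push Not at hc
  have hc' : ⟪w y, coroot (S.simple j)⟫ < 0 := by
    by_contra h
    push Not at h
    rw [coroot_nonneg_iff (S.simple_ne j)] at h
    linarith
  have h1 := hmax (reflP (S.simple j) 0 * w) ⟨mul_mem (S.refl_W0 (S.simple_R0 j)) hw.1, by
    rw [Equiv.Perm.mul_apply, reflP_zero_apply, inner_sub_right, real_inner_smul_right]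
    have := mul_nonneg (neg_nonneg.2 hc'.le) (hx j)
    linarith [hw.2]⟩
  rw [Equiv.Perm.mul_apply, reflP_zero_apply, inner_sub_right, real_inner_smul_right] at h1
  have := mul_pos (neg_pos.2 hc') (S.rho_simple j)
  linarith

lemma rho_dom : S.Dom S.rho := fun j => (S.rho_simple j).le

lemma dom_max {x y : V} (hx : S.Dom x) (hy : S.Dom y) {w : Equiv.Perm V} (h : w ∈ S.W0) :
    ⟪x, w y⟫ ≤ ⟪x, y⟫ := by
  obtain ⟨v, hv, hd, hle⟩ := S.exists_dom hx (w y)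
  have := S.dom_unique hy (mul_mem hv h) hd
  rw [Equiv.Perm.mul_apply] at this
  rwa [this] at hle

lemma Plat_W0 {w : Equiv.Perm V} (h : w ∈ S.W0) {x : V} (hx : x ∈ S.Plat) : w x ∈ S.Plat := by
  intro α hα
  obtain ⟨k, hk⟩ := hx _ (W0_mem (inv_mem h) hα)
  exact ⟨k, by rw [W0_inner' h, ← W0_coroot (inv_mem h), hk]⟩

lemma R0_Plat {α : V} (h : α ∈ S.R0) : α ∈ S.Plat := fun β hβ => S.cryst β hβ α h

lemma Plat_add {x y : V} (hx : x ∈ S.Plat) (hy : y ∈ S.Plat) : x + y ∈ S.Plat := by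
  intro α hα
  obtain ⟨k, hk⟩ := hx α hα
  obtain ⟨l, hl⟩ := hy α hα
  exact ⟨k + l, by rw [inner_add_left, hk, hl]; push_cast; rfl⟩

end Setup

namespace Setup
variable (S : Setup V)

/-! ### Antisymmetrizers and the Weyl denominator formula -/

/-- plane wave -/
def ex (x ξ : V) : ℂ := Complex.exp (Complex.I * (⟪ξ, x⟫ : ℂ))

lemma ex_add (x y ξ : V) : ex (x + y) ξ = ex x ξ * ex y ξ := by
  rw [ex, ex, ex, ← Complex.exp_add, inner_add_right]; push_cast; ring_nf

/-- the antisymmetrizer -/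
def An (x ξ : V) : ℂ := ∑ w ∈ S.W0F, (detP w : ℂ) * ex x (w ξ)

lemma chiW_eq (lam ξ : V) : S.chiW lam ξ = (S.weylDenom ξ)⁻¹ * S.An (lam + S.rho) ξ := by
  rw [chiW, An]
  congr 1
  have : (S.W0 : Set (Equiv.Perm V)) = (S.W0F : Set (Equiv.Perm V)) := by ext; simp
  rw [this, finsum_mem_coe_finset]
  refine Finset.sum_congr rfl fun w hw => ?_
  rw [S.neg_one_len0 (S.mem_W0F.1 hw), ex]

lemma An_W0 {v : Equiv.Perm V} (hv : v ∈ S.W0) (x ξ : V) :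
    S.An (v x) ξ = detP v * S.An x ξ := by
  have hd : detP v * detP v⁻¹ = 1 := by
    rw [← S.detP_W0_mul hv (inv_mem hv), mul_inv_cancel, detP_one]
  rw [An, An, Finset.mul_sum]
  refine Finset.sum_nbij' (fun w => v⁻¹ * w) (fun w => v * w) ?_ ?_ ?_ ?_ ?_
  · intro w hw; simp only [mem_W0F] at hw ⊢; exact mul_mem (inv_mem hv) hw
  · intro w hw; simp only [mem_W0F] at hw ⊢; exact mul_mem hv hw
  · intro w _; simp
  · intro w _; simp
  · intro w hw
    simp only [mem_W0F] at hw
    rw [S.detP_W0_mul (inv_mem hv) hw, ex, ex, Equiv.Perm.mul_apply, W0_inner' (inv_mem hv),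
      inv_inv, ← mul_assoc]
    congr 1
    rw [← Complex.ofReal_mul, ← mul_assoc, hd, one_mul]

lemma An_refl {α : V} (hα : α ∈ S.R0) (x ξ : V) : S.An (reflP α 0 x) ξ = - S.An x ξ := by
  rw [S.An_W0 (S.refl_W0 hα), detP_reflP (S.ne_zero hα)]; push_cast; ring

lemma An_zero_of_neg {x ξ : V} (h : S.An x ξ = - S.An x ξ) : S.An x ξ = 0 := by
  have : (2:ℂ) * S.An x ξ = 0 := by linear_combination h
  simpa using this

/-- coefficient of the expanded Weyl denominator -/
def cf (x : V) : ℂ :=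
  ∑ Φ ∈ S.Rpos.powerset.filter (fun Φ => S.rho - ∑ α ∈ Φ, α = x), (-1 : ℂ) ^ Φ.card

/-- exponents in the expanded Weyl denominator -/
def Xs : Finset V := S.Rpos.powerset.image (fun Φ => S.rho - ∑ α ∈ Φ, α)

lemma weylDenom_expand (ξ : V) :
    S.weylDenom ξ = ∑ Φ ∈ S.Rpos.powerset, (-1 : ℂ) ^ Φ.card * ex (S.rho - ∑ α ∈ Φ, α) ξ := by
  rw [weylDenom, Finset.prod_sub]
  refine Finset.sum_congr rfl fun Φ hΦ => ?_
  rw [Finset.mem_powerset] at hΦ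
  rw [mul_assoc, ← Complex.exp_sum, ← Complex.exp_sum, ← Complex.exp_add, ex]
  congr 2
  have h : S.rho = (2⁻¹ : ℝ) • ∑ α ∈ S.Rpos \ Φ, α + (2⁻¹ : ℝ) • ∑ α ∈ Φ, α := by
    rw [rho, ← Finset.sum_sdiff hΦ, smul_add]
  have h2 : S.rho - ∑ α ∈ Φ, α
      = (2⁻¹ : ℝ) • ∑ α ∈ S.Rpos \ Φ, α - (2⁻¹ : ℝ) • ∑ α ∈ Φ, α := by
    rw [h]; module
  rw [h2, inner_sub_right, real_inner_smul_right, real_inner_smul_right, inner_sum, inner_sum,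
    Finset.sum_neg_distrib, ← Finset.sum_div, ← Finset.sum_div, ← Finset.mul_sum, ← Finset.mul_sum]
  push_cast
  ring

lemma weylDenom_cf (ξ : V) : S.weylDenom ξ = ∑ x ∈ S.Xs, S.cf x * ex x ξ := by
  rw [weylDenom_expand, Xs]
  rw [← Finset.sum_fiberwise_of_maps_to (s := S.Rpos.powerset)
    (g := fun Φ => S.rho - ∑ α ∈ Φ, α) (fun Φ hΦ => Finset.mem_image.2 ⟨Φ, hΦ, rfl⟩)]
  refine Finset.sum_congr rfl fun x _ => ?_
  rw [cf, Finset.sum_mul]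
  refine Finset.sum_congr rfl fun Φ hΦ => ?_
  rw [(Finset.mem_filter.1 hΦ).2]

lemma mem_Xs_of_cf {x : V} (h : S.cf x ≠ 0) : x ∈ S.Xs := by
  by_contra hc
  apply h
  rw [cf]
  apply Finset.sum_eq_zero
  intro Φ hΦ
  exfalso
  rw [Finset.mem_filter] at hΦ
  exact hc (Finset.mem_image.2 ⟨Φ, hΦ.1, hΦ.2⟩)

/-- action of a simple reflection on subsets of the positive roots -/
def sg (j : Fin S.n) (Φ : Finset V) : Finset V :=
  ((Φ.erase (S.simple j)).image (reflP (S.simple j) 0)) ∪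
    (if S.simple j ∈ Φ then ∅ else {S.simple j})

lemma simple_not_mem_image {j : Fin S.n} {Φ : Finset V} (h : Φ ⊆ S.Rpos) :
    S.simple j ∉ (Φ.erase (S.simple j)).image (reflP (S.simple j) 0) := by
  intro hc
  obtain ⟨β, hβ, e⟩ := Finset.mem_image.1 hc
  exact S.refl_simple_ne (h (Finset.mem_of_mem_erase hβ)) j e

lemma sg_sub {j : Fin S.n} {Φ : Finset V} (h : Φ ⊆ S.Rpos) : S.sg j Φ ⊆ S.Rpos := by
  intro β hβ
  rw [sg, Finset.mem_union] at hβ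
  rcases hβ with hβ | hβ
  · obtain ⟨γ, hγ, rfl⟩ := Finset.mem_image.1 hβ
    rw [Finset.mem_erase] at hγ
    exact S.refl_simple_pos (h hγ.2) j hγ.1
  · split_ifs at hβ
    · simp at hβ
    · rw [Finset.mem_singleton.1 hβ]; exact S.simple_mem j

lemma mem_sg_simple {j : Fin S.n} {Φ : Finset V} (h : Φ ⊆ S.Rpos) :
    S.simple j ∈ S.sg j Φ ↔ S.simple j ∉ Φ := by
  rw [sg, Finset.mem_union, or_iff_right (S.simple_not_mem_image h)]
  split_ifs with h1 <;> simp [h1]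

lemma mem_sg {j : Fin S.n} {Φ : Finset V} {β : V} (hβ : β ≠ S.simple j)
    (hβ' : reflP (S.simple j) 0 β ≠ S.simple j) :
    β ∈ S.sg j Φ ↔ reflP (S.simple j) 0 β ∈ Φ := by
  rw [sg, Finset.mem_union, Finset.mem_image]
  constructor
  · rintro (⟨γ, hγ, rfl⟩ | h)
    · rw [reflP_refl]; exact Finset.mem_of_mem_erase hγ
    · split_ifs at h
      · simp at h
      · exact absurd (Finset.mem_singleton.1 h) hβ
  · intro h
    exact Or.inl ⟨_, Finset.mem_erase.2 ⟨hβ', h⟩, reflP_refl _ _⟩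

lemma sg_sg {j : Fin S.n} {Φ : Finset V} (h : Φ ⊆ S.Rpos) : S.sg j (S.sg j Φ) = Φ := by
  have h2 := S.sg_sub (j := j) h
  have h3 := S.sg_sub (j := j) h2
  ext β
  by_cases hp : β ∈ S.Rpos
  · by_cases hb : β = S.simple j
    · rw [hb, S.mem_sg_simple h2, S.mem_sg_simple h, not_not]
    · have h4 := S.refl_simple_ne hp j
      rw [S.mem_sg hb h4, S.mem_sg h4 (by rwa [reflP_refl]), reflP_refl]
  · exact ⟨fun hh => absurd (h3 hh) hp, fun hh => absurd (h hh) hp⟩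

lemma sg_card {j : Fin S.n} {Φ : Finset V} (h : Φ ⊆ S.Rpos) :
    (-1 : ℂ) ^ (S.sg j Φ).card = - (-1 : ℂ) ^ Φ.card := by
  have hd : Disjoint ((Φ.erase (S.simple j)).image (reflP (S.simple j) 0))
      (if S.simple j ∈ Φ then ∅ else {S.simple j}) := by
    split_ifs
    · simp
    · rw [Finset.disjoint_singleton_right]; exact S.simple_not_mem_image h
  rw [sg, Finset.card_union_of_disjoint hd,
    Finset.card_image_of_injective _ (reflP (S.simple j) 0).injective]
  split_ifs with h1
  · rw [← Finset.card_erase_add_one h1]; simp [pow_succ]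
  · rw [Finset.erase_eq_of_notMem h1]; simp [pow_succ]

lemma sg_sum {j : Fin S.n} {Φ : Finset V} (h : Φ ⊆ S.Rpos) :
    S.rho - ∑ α ∈ S.sg j Φ, α = reflP (S.simple j) 0 (S.rho - ∑ α ∈ Φ, α) := by
  have hd : Disjoint ((Φ.erase (S.simple j)).image (reflP (S.simple j) 0))
      (if S.simple j ∈ Φ then ∅ else {S.simple j}) := by
    split_ifs
    · simp
    · rw [Finset.disjoint_singleton_right]; exact S.simple_not_mem_image h
  rw [W0_sub (S.refl_W0 (S.simple_R0 j)), reflL_rho, sg, Finset.sum_union hd,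
    Finset.sum_image (fun a _ b _ e => (reflP (S.simple j) 0).injective e)]
  have e : ∑ x ∈ Φ.erase (S.simple j), reflP (S.simple j) 0 x
      = reflP (S.simple j) 0 (∑ x ∈ Φ.erase (S.simple j), x) := by
    rw [← reflL_apply, map_sum]; rfl
  rw [e]
  split_ifs with h1
  · conv_rhs => rw [← Finset.add_sum_erase _ _ h1, reflP_add, reflP_self (S.simple_ne j)]
    rw [Finset.sum_empty]; abel
  · rw [Finset.erase_eq_of_notMem h1]; simp only [Finset.sum_singleton]; abel

lemma cf_refl (j : Fin S.n) (x : V) : S.cf (reflP (S.simple j) 0 x) = - S.cf x := by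
  rw [cf, cf, ← Finset.sum_neg_distrib]
  refine Finset.sum_nbij' (S.sg j) (S.sg j) ?_ ?_ ?_ ?_ ?_
  · intro Φ hΦ
    simp only [Finset.mem_filter, Finset.mem_powerset] at hΦ ⊢
    exact ⟨S.sg_sub hΦ.1, by rw [S.sg_sum hΦ.1, hΦ.2, reflP_refl]⟩
  · intro Φ hΦ
    simp only [Finset.mem_filter, Finset.mem_powerset] at hΦ ⊢
    exact ⟨S.sg_sub hΦ.1, by rw [S.sg_sum hΦ.1, hΦ.2]⟩
  · intro Φ hΦ
    simp only [Finset.mem_filter, Finset.mem_powerset] at hΦ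
    exact S.sg_sg hΦ.1
  · intro Φ hΦ
    simp only [Finset.mem_filter, Finset.mem_powerset] at hΦ
    exact S.sg_sg hΦ.1
  · intro Φ hΦ
    simp only [Finset.mem_filter, Finset.mem_powerset] at hΦ
    rw [S.sg_card hΦ.1, neg_neg]

lemma cf_W0 {w : Equiv.Perm V} (hw : w ∈ S.W0) (x : V) : S.cf (w x) = detP w * S.cf x := by
  obtain ⟨l, rfl⟩ := S.exists_wd hw
  clear hw
  induction l with
  | nil => simp [detP_one]
  | cons j l ih =>
    rw [wd_cons, Equiv.Perm.mul_apply, cf_refl, ih,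
      S.detP_W0_mul (S.refl_W0 (S.simple_R0 j)) (S.wd_mem l), detP_reflP (S.simple_ne j)]
    push_cast; ring

lemma sum_eq_zero_iff' {Φ : Finset V} (h : Φ ⊆ S.Rpos) (h0 : ∑ α ∈ Φ, α = 0) : Φ = ∅ := by
  by_contra hne
  have h1 : ⟪S.rho, ∑ α ∈ Φ, α⟫ = 0 := by rw [h0, inner_zero_right]
  rw [inner_sum] at h1
  have h2 : 0 < ∑ α ∈ Φ, ⟪S.rho, α⟫ :=
    Finset.sum_pos (fun α hα => S.rho_pos (h hα)) (Finset.nonempty_iff_ne_empty.2 hne)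
  linarith

lemma cf_rho : S.cf S.rho = 1 := by
  have : S.Rpos.powerset.filter (fun Φ => S.rho - ∑ α ∈ Φ, α = S.rho) = {∅} := by
    ext Φ
    simp only [Finset.mem_filter, Finset.mem_powerset, Finset.mem_singleton, sub_eq_self]
    constructor
    · rintro ⟨h, h0⟩; exact S.sum_eq_zero_iff' h h0
    · rintro rfl; simp
  rw [cf, this]; simp

lemma cf_ne_zero {x : V} (h : S.cf x ≠ 0) : ∃ w ∈ S.W0, x = w S.rho := by
  obtain ⟨w, hw, hd, -⟩ := S.exists_dom S.rho_dom x
  have hdet : (detP w : ℂ) ≠ 0 := by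
    obtain ⟨l, rfl⟩ := S.exists_wd hw
    rw [detP_wd]; simp
  have h1 : S.cf (w x) ≠ 0 := by
    rw [S.cf_W0 hw]; exact mul_ne_zero hdet h
  obtain ⟨Φ, hΦ, e⟩ := Finset.mem_image.1 (S.mem_Xs_of_cf h1)
  rw [Finset.mem_powerset] at hΦ
  have h2 : ∀ j, ⟪w x, coroot (S.simple j)⟫ ≠ 0 := by
    intro j hj
    have h3 := S.cf_refl j (w x)
    rw [reflP_zero_apply, hj, zero_smul, sub_zero] at h3
    apply h1
    have : (2:ℂ) * S.cf (w x) = 0 := by linear_combination h3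
    simpa using this
  have h3 : ∀ j, ⟪∑ α ∈ Φ, α, S.simple j⟫ ≤ 0 := by
    intro j
    by_contra hc
    push Not at hc
    rw [← coroot_pos_iff (S.simple_ne j)] at hc
    have hint : ∃ k : ℤ, ⟪∑ α ∈ Φ, α, coroot (S.simple j)⟫ = k := by
      rw [sum_inner]
      have : ∀ α : V, ∃ k : ℤ, α ∈ Φ → ⟪α, coroot (S.simple j)⟫ = k := by
        intro α
        by_cases hα : α ∈ Φ
        · obtain ⟨k, hk⟩ := S.cryst _ (S.simple_R0 j) α (S.pos_R0 (hΦ hα))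
          exact ⟨k, fun _ => hk⟩
        · exact ⟨0, fun h => absurd h hα⟩
      choose k hk using this
      exact ⟨∑ α ∈ Φ, k α, by push_cast; exact Finset.sum_congr rfl fun α hα => hk α hα⟩
    obtain ⟨k, hk⟩ := hint
    have h4 := (coroot_nonneg_iff (S.simple_ne j) _).2 (hd j)
    have h5 : 0 < ⟪w x, coroot (S.simple j)⟫ := lt_of_le_of_ne h4 (h2 j).symm
    rw [← e, inner_sub_left, rho_coroot, hk] at h5
    rw [hk] at hc
    have h6 : (0:ℤ) < k := by exact_mod_cast hc
    have h7 : k < (1:ℤ) := by exact_mod_cast (by linarith : (k:ℝ) < 1)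
    omega
  have h4 : ∑ α ∈ Φ, α = 0 := by
    rw [← inner_self_eq_zero (𝕜 := ℝ)]
    apply le_antisymm _ real_inner_self_nonneg
    conv_lhs => rw [inner_sum]
    apply Finset.sum_nonpos
    intro α hα
    rw [S.inner_eq_sum]
    exact Finset.sum_nonpos fun j _ =>
      mul_nonpos_of_nonneg_of_nonpos (S.co_nonneg (hΦ hα) j) (h3 j)
  rw [h4, sub_zero] at e
  exact ⟨w⁻¹, inv_mem hw, by rw [e]; simp⟩

lemma denominator (ξ : V) : S.An S.rho ξ = S.weylDenom ξ := by
  have hinj : Set.InjOn (fun w : Equiv.Perm V => w S.rho) (S.W0F : Set (Equiv.Perm V)) := by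
    intro w hw v hv e
    simp only [Finset.mem_coe, mem_W0F] at hw hv
    have : v⁻¹ * w = 1 := by
      apply S.free (mul_mem (inv_mem hv) hw)
      have e' : w S.rho = v S.rho := e
      rw [Equiv.Perm.mul_apply, e']; simp
    exact (inv_mul_eq_one.1 this).symm
  have h1 : S.weylDenom ξ = ∑ x ∈ S.W0F.image (fun w => w S.rho), S.cf x * ex x ξ := by
    rw [weylDenom_cf]
    symm
    apply Finset.sum_subset
    · intro x hx
      obtain ⟨w, hw, rfl⟩ := Finset.mem_image.1 hx
      rw [mem_W0F] at hw
      apply S.mem_Xs_of_cf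
      rw [S.cf_W0 hw, cf_rho, mul_one]
      obtain ⟨l, rfl⟩ := S.exists_wd hw
      rw [detP_wd]; simp
    · intro x _ hx
      have : S.cf x = 0 := by
        by_contra hc
        obtain ⟨w, hw, rfl⟩ := S.cf_ne_zero hc
        exact hx (Finset.mem_image.2 ⟨w, by simpa using hw, rfl⟩)
      rw [this, zero_mul]
  rw [h1, Finset.sum_image hinj, An]
  refine Finset.sum_nbij' (fun w => w⁻¹) (fun w => w⁻¹) ?_ ?_ ?_ ?_ ?_
  · intro w hw; simpa using hw
  · intro w hw; simpa using hw
  · intro w _; simp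
  · intro w _; simp
  · intro w hw
    rw [mem_W0F] at hw
    have hd : detP w * detP w⁻¹ = 1 := by
      rw [← S.detP_W0_mul hw (inv_mem hw), mul_inv_cancel, detP_one]
    have hd2 : detP w = detP w⁻¹ := by
      have : detP w * detP w = 1 := by
        obtain ⟨l, rfl⟩ := S.exists_wd hw
        rw [detP_wd, ← mul_pow]; simp
      have h0 : detP w ≠ 0 := left_ne_zero_of_mul (by rw [this]; exact one_ne_zero)
      exact mul_left_cancel₀ h0 (by rw [this, hd])
    rw [S.cf_W0 (inv_mem hw), cf_rho, mul_one, ← hd2, ex, ex, W0_inner' hw]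

end Setup

namespace Setup
variable (S : Setup V)

/-! ### The affine root and the alcove -/

lemma hs_R0 : S.hs ∈ S.R0 := S.pos_R0 S.hs_mem

lemma hroot_R0 : S.hroot ∈ S.R0 := S.pos_R0 S.hroot_mem

lemma hs_dom : S.Dom S.hs := by
  intro j
  obtain ⟨f, hf⟩ := S.hs_highest _ (S.reflP_mem (S.simple_R0 j) S.hs_R0) (reflP_inner _ _ _)
  have h := congrArg (S.co j) hf
  rw [S.co_sum, reflP_zero_apply, sub_sub_cancel, map_smul, co_simple, if_pos rfl,
    smul_eq_mul, mul_one] at h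
  rw [← coroot_nonneg_iff (S.simple_ne j), h]
  positivity

lemma short_bound {β α : V} (hβ : β ∈ S.R0) (hα : α ∈ S.R0) (hs : ⟪β, β⟫ = ⟪S.hs, S.hs⟫) :
    |⟪β, coroot α⟫| ≤ 1 ∨ β = α ∨ β = -α := by
  obtain ⟨k, hk⟩ := S.cryst α hα β hβ
  have hle : ⟪β, β⟫ ≤ ⟪α, α⟫ := hs ▸ S.hs_short α hα
  have hp := inner_self_pos' (S.ne_zero hα)
  have hin : 2 * ⟪β, α⟫ = k * ⟪α, α⟫ := by
    rw [← hk, inner_coroot]; field_simp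
  rcases le_or_gt k (-2) with h | h
  · right; right
    have hk2 : (k:ℝ) ≤ -2 := by exact_mod_cast h
    have : ⟪β + α, β + α⟫ ≤ 0 := by
      rw [inner_add_left, inner_add_right, inner_add_right, real_inner_comm β α]
      nlinarith
    exact eq_neg_of_add_eq_zero_left (inner_self_eq_zero.1 (le_antisymm this real_inner_self_nonneg))
  rcases le_or_gt 2 k with h' | h'
  · right; left
    have hk2 : (2:ℝ) ≤ k := by exact_mod_cast h'
    have : ⟪β - α, β - α⟫ ≤ 0 := by
      rw [inner_sub_left, inner_sub_right, inner_sub_right, real_inner_comm β α]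
      nlinarith
    exact sub_eq_zero.1 (inner_self_eq_zero.1 (le_antisymm this real_inner_self_nonneg))
  · left
    rw [hk, abs_le]
    constructor
    · exact_mod_cast (by omega : -1 ≤ k)
    · exact_mod_cast (by omega : k ≤ 1)

lemma irred_inner {α β : V} (hα : α ∈ S.R0) (hβ : β ∈ S.R0) : ∃ w ∈ S.W0, ⟪w α, β⟫ ≠ 0 := by
  by_contra! hc
  apply S.irred
  refine ⟨{γ | γ ∈ S.R0 ∧ ∃ w ∈ S.W0, ⟪w α, γ⟫ ≠ 0}, {γ | γ ∈ S.R0 ∧ ∀ w ∈ S.W0, ⟪w α, γ⟫ = 0},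
    ⟨α, hα, 1, one_mem _, (inner_self_pos' (S.ne_zero hα)).ne'⟩, ⟨β, hβ, hc⟩, ?_, ?_⟩
  · ext γ
    simp only [Set.mem_union, Set.mem_setOf_eq, Finset.mem_coe]
    constructor
    · rintro (h | h) <;> exact h.1
    · intro h
      by_cases h1 : ∃ w ∈ S.W0, ⟪w α, γ⟫ ≠ 0
      · exact Or.inl ⟨h, h1⟩
      · push Not at h1; exact Or.inr ⟨h, h1⟩
  · rintro γ ⟨hγ, w, hw, hne⟩ δ ⟨hδ, h0⟩
    have h1 := h0 (reflP γ 0 * w) (mul_mem (S.refl_W0 hγ) hw)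
    rw [Equiv.Perm.mul_apply, reflP_zero_apply, inner_sub_left, real_inner_smul_left, h0 w hw,
      zero_sub, neg_eq_zero, mul_eq_zero, coroot_zero_iff (S.ne_zero hγ)] at h1
    exact h1.resolve_left hne

lemma hs_coroot_highest {x α : V} (hx : S.Dom x) (hα : α ∈ S.R0) :
    ⟪x, coroot α⟫ ≤ ⟪x, coroot S.hs⟫ := by
  obtain ⟨w, hw, hd, hle⟩ := S.exists_dom hx α
  have hβ : w α ∈ S.R0 := W0_mem hw hα
  have hlen : ⟪w α, w α⟫ = ⟪α, α⟫ := W0_inner hw _ _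
  have hp := inner_self_pos' (S.ne_zero hα)
  generalize w α = β at *
  have h1 : ⟪x, coroot α⟫ ≤ ⟪x, coroot β⟫ := by
    rw [inner_coroot, inner_coroot, hlen]
    gcongr
  refine h1.trans ?_
  have hpos : 0 < ⟪S.hs, β⟫ := by
    obtain ⟨v, hv, hne⟩ := S.irred_inner hβ S.hs_R0
    rcases lt_or_gt_of_ne hne with h | h
    · have h2 := S.dom_max S.hs_dom hd (mul_mem (S.refl_W0 S.hs_R0) hv)
      have h3 : ⟪S.hs, (reflP S.hs 0 * v) β⟫ = - ⟪v β, S.hs⟫ := by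
        rw [Equiv.Perm.mul_apply, ← reflP_inner S.hs, reflP_refl,
          reflP_self (S.ne_zero S.hs_R0), inner_neg_left, real_inner_comm]
      linarith
    · have h2 := S.dom_max S.hs_dom hd hv
      rw [real_inner_comm] at h
      linarith
  have hps := inner_self_pos' (S.ne_zero S.hs_R0)
  rcases S.short_bound S.hs_R0 hβ rfl with hb | hb | hb
  · obtain ⟨k, hk⟩ := S.cryst β hβ S.hs S.hs_R0
    have h2 := (coroot_pos_iff (S.ne_zero hβ) _).2 hpos
    have h3 := (abs_le.1 hb).2
    have hk1 : k = 1 := by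
      rw [hk] at h2 h3
      have : 0 < k := by exact_mod_cast h2
      have : k ≤ 1 := by exact_mod_cast h3
      omega
    rw [hk1, inner_coroot, hlen] at hk
    have h4 : 2 * ⟪S.hs, β⟫ = ⟪α, α⟫ := by field_simp at hk; push_cast at hk; linarith
    have hγ := S.reflP_mem S.hs_R0 hβ
    have hneg : reflP S.hs 0 β ∉ S.Rpos := by
      intro hc
      have h5 := S.hs_dom.pos hc
      rw [← reflP_inner S.hs, reflP_refl, reflP_self (S.ne_zero S.hs_R0), inner_neg_left] at h5
      linarith
    have h6 := hx.pos (S.neg_pos_of_not hγ hneg)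
    rw [reflP_zero_apply, neg_sub, inner_sub_right, real_inner_smul_right, inner_coroot,
      real_inner_comm, h4] at h6
    rw [inner_coroot, inner_coroot, hlen, div_le_div_iff₀ hp hps]
    have h7 : ⟪x, β⟫ ≤ ⟪α, α⟫ / ⟪S.hs, S.hs⟫ * ⟪x, S.hs⟫ := by linarith
    rw [div_mul_eq_mul_div, le_div_iff₀ hps] at h7
    linarith
  · rw [hb]
  · rw [hb, inner_neg_left] at hpos
    have := inner_self_pos' (S.ne_zero hβ)
    linarith

lemma a0_neg_pos : -S.a0 ∈ S.Rpos := by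
  rcases S.admissible with ⟨-, h⟩ | ⟨-, h⟩ <;> rw [h, neg_neg]
  · exact S.hs_mem
  · exact S.hroot_mem

lemma a0_R0 : S.a0 ∈ S.R0 := by
  have := S.neg_mem (S.pos_R0 S.a0_neg_pos)
  rwa [neg_neg] at this

@[simp] lemma alpha_zero : S.alpha 0 = S.a0 := by simp [alpha]

@[simp] lemma alpha_succ (j : Fin S.n) : S.alpha j.succ = S.simple j := by simp [alpha]

@[simp] lemma kconst_zero : S.kconst 0 = S.c := by simp [kconst]

@[simp] lemma kconst_succ (j : Fin S.n) : S.kconst j.succ = 0 := by simp [kconst]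

lemma alpha_R0 (j : Fin (S.n + 1)) : S.alpha j ∈ S.R0 := by
  induction j using Fin.cases with
  | zero => simpa using S.a0_R0
  | succ j => simpa using S.simple_R0 j

lemma alpha_inj : Function.Injective S.alpha := by
  have h0 : ∀ j, S.a0 ≠ S.simple j := by
    intro j h
    exact S.neg_not_pos (S.simple_mem j) (h ▸ S.a0_neg_pos)
  intro i j h
  induction i using Fin.cases with
  | zero =>
    induction j using Fin.cases with
    | zero => rfl
    | succ j => simp at h; exact absurd h (h0 j)
  | succ i =>
    induction j using Fin.cases with
    | zero => simp at h; exact absurd h.symm (h0 i)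
    | succ j => simp at h; rw [S.simple_inj h]

lemma mem_Pc_iff {x : V} (hx : x ∈ S.Plat) : x ∈ S.Pc ↔ ∀ j, 0 ≤ S.aFun j x := by
  have hc := S.admissible
  have hp := inner_self_pos' (S.ne_zero S.hroot_R0)
  have hu : 0 < 2 / ⟪S.hroot, S.hroot⟫ := by positivity
  constructor
  · rintro ⟨-, h⟩ j
    rcases hc with ⟨hh, ha⟩ | ⟨hh, ha⟩
    · induction j using Fin.cases with
      | zero =>
        have := (h _ S.hs_mem).2
        rw [hh] at this
        simp only [aFun, alpha_zero, kconst_zero, ha, coroot_neg, inner_neg_right]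
        linarith
      | succ j =>
        have := (h _ (S.simple_mem j)).1
        rw [hh] at this
        simpa [aFun] using this
    · induction j using Fin.cases with
      | zero =>
        have := (h _ S.hroot_mem).2
        rw [hh] at this
        simp only [aFun, alpha_zero, kconst_zero, ha, coroot_neg, inner_neg_right]
        rw [coroot]
        linarith
      | succ j =>
        have := (h _ (S.simple_mem j)).1
        rw [hh, real_inner_smul_right] at this
        simp only [aFun, alpha_succ, kconst_succ, add_zero]
        rw [coroot_nonneg_iff (S.simple_ne j)]
        exact nonneg_of_mul_nonneg_right this hu
  · intro h
    have hd : S.Dom x := by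
      intro j
      have := h j.succ
      simp only [aFun, alpha_succ, kconst_succ, add_zero] at this
      rwa [coroot_nonneg_iff (S.simple_ne j)] at this
    have h0 := h 0
    simp only [aFun, alpha_zero, kconst_zero] at h0
    refine ⟨hx, fun α hα => ?_⟩
    rcases hc with ⟨hh, ha⟩ | ⟨hh, ha⟩
    · rw [ha, coroot_neg, inner_neg_right] at h0
      rw [hh]
      exact ⟨(coroot_nonneg_iff (S.ne_zero (S.pos_R0 hα)) x).2 (hd.pos hα),
        (S.hs_coroot_highest hd (S.pos_R0 hα)).trans (by linarith)⟩
    · rw [ha, coroot_neg, inner_neg_right, coroot, real_inner_smul_right] at h0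
      rw [hh, real_inner_smul_right]
      refine ⟨mul_nonneg hu.le (hd.pos hα), ?_⟩
      have h1 : ⟪x, α⟫ ≤ ⟪x, S.hroot⟫ := by
        obtain ⟨f, hf⟩ := S.hroot_highest α (S.pos_R0 hα)
        have h2 : 0 ≤ ⟪x, S.hroot - α⟫ := by
          rw [hf, inner_sum]
          refine Finset.sum_nonneg fun j _ => ?_
          rw [real_inner_smul_right]
          exact mul_nonneg (by positivity) (hd j)
        rw [inner_sub_right] at h2; linarith
      have := mul_le_mul_of_nonneg_left h1 hu.le
      linarith

/-! ### Periodicity -/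

lemma refl_coroot (α β : V) : coroot (reflP α 0 β) = reflP α 0 (coroot β) := by
  rw [coroot, coroot, reflP_inner, reflP_smul]

lemma halfsum_coroot_simple (j : Fin S.n) :
    ⟪(2⁻¹ : ℝ) • ∑ α ∈ S.Rpos, coroot α, S.simple j⟫ = 1 := by
  have h := S.sum_refl_simple (fun α => ⟪coroot α, S.simple j⟫) j
  have h2 : ∀ α : V, ⟪coroot (reflP (S.simple j) 0 α), S.simple j⟫ = - ⟪coroot α, S.simple j⟫ := by
    intro α
    rw [refl_coroot, ← reflP_inner (S.simple j), reflP_refl, reflP_self (S.simple_ne j),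
      inner_neg_right]
  simp only [h2, Finset.sum_neg_distrib] at h
  rw [real_inner_smul_left, sum_inner, ← Finset.add_sum_erase _ _ (S.simple_mem j),
    real_inner_comm, inner_self_coroot (S.simple_ne j)]
  linarith

lemma halfsum_coroot_int {β : V} (hβ : β ∈ S.R0) :
    ∃ k : ℤ, ⟪(2⁻¹ : ℝ) • ∑ α ∈ S.Rpos, coroot α, β⟫ = k := by
  have key : ∀ β ∈ S.Rpos, ∃ k : ℤ, ⟪(2⁻¹ : ℝ) • ∑ α ∈ S.Rpos, coroot α, β⟫ = k := by
    intro β hβ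
    have : ∀ j, ∃ k : ℕ, S.co j β = k := fun j => S.co_nat hβ j
    choose k hk using this
    refine ⟨∑ j, (k j : ℤ), ?_⟩
    rw [S.inner_eq_sum]
    push_cast
    exact Finset.sum_congr rfl fun j _ => by rw [halfsum_coroot_simple, mul_one, hk]
  rcases S.pos_or_neg hβ with h | h
  · exact key β h
  · obtain ⟨k, hk⟩ := key _ h
    rw [inner_neg_right] at hk
    exact ⟨-k, by push_cast; linarith⟩

lemma node_int {μ β : V} (hμ : μ ∈ S.Phatc) (hβ : β ∈ S.R0) (hl : ⟪β, β⟫ = ⟪S.a0, S.a0⟫) :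
    ∃ k : ℤ, ⟪S.rhoHat + μ, β⟫ = k := by
  obtain ⟨k, hk⟩ := hμ.1 β hβ
  have hb := inner_self_pos' (S.ne_zero hβ)
  rcases S.admissible with ⟨hh, ha⟩ | ⟨hh, ha⟩
  · rw [hh, coroot_coroot (S.ne_zero hβ)] at hk
    obtain ⟨l, hl⟩ := S.halfsum_coroot_int hβ
    refine ⟨l + k, ?_⟩
    have : S.rhoHat = (2⁻¹ : ℝ) • ∑ α ∈ S.Rpos, coroot α := by simp [rhoHat, hh]
    rw [inner_add_left, hk, this, hl]; push_cast; rfl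
  · rw [ha, inner_neg_neg] at hl
    have e : S.hat β = coroot β := by rw [hh, coroot, hl]
    rw [e, coroot_coroot (S.ne_zero hβ)] at hk
    obtain ⟨l, hl'⟩ := S.rho_Plat β hβ
    refine ⟨l + k, ?_⟩
    have : S.rhoHat = (2 / ⟪S.hroot, S.hroot⟫) • S.rho := by
      simp only [rhoHat, hh, rho]
      rw [← Finset.smul_sum, smul_comm]
    rw [inner_add_left, hk, this, real_inner_smul_left, ← hl, ← real_inner_smul_right]
    rw [coroot] at hl'
    rw [hl']; push_cast; rfl

/-- the shifted level `h + c` -/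
def Hc : ℝ := (1 - ⟪S.rho, coroot S.a0⟫) + (S.c : ℝ)

/-- the node -/
def nd (μ : V) : V := (2 * Real.pi / S.Hc) • (S.rhoHat + μ)

lemma ex_period {μ : V} (hμ : μ ∈ S.Phatc) {w : Equiv.Perm V} (hw : w ∈ S.W0) :
    ex (-(S.Hc • S.a0)) (w (S.nd μ)) = 1 := by
  obtain ⟨k, hk⟩ := S.node_int hμ (W0_mem (inv_mem hw) S.a0_R0) (W0_inner (inv_mem hw) _ _)
  rw [ex, inner_neg_right, real_inner_smul_right, W0_inner' hw, nd, real_inner_smul_left, hk]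
  by_cases h : S.Hc = 0
  · simp [h]
  · have e : S.Hc * (2 * Real.pi / S.Hc * k) = 2 * Real.pi * k := by field_simp
    rw [e, Complex.exp_eq_one_iff]
    exact ⟨-k, by push_cast; ring⟩

/-- shifted constants -/
def kc (j : Fin (S.n + 1)) : ℝ := if j = 0 then S.Hc else 0

lemma An_aff {μ : V} (hμ : μ ∈ S.Phatc) (j : Fin (S.n + 1)) (x : V) :
    S.An (reflP (S.alpha j) (S.kc j) x) (S.nd μ) = - S.An x (S.nd μ) := by
  induction j using Fin.cases with
  | zero =>
    have e : reflP (S.alpha 0) (S.kc 0) x = reflP S.a0 0 x + -(S.Hc • S.a0) := by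
      rw [reflP_apply, reflP_zero_apply, alpha_zero, kc, if_pos rfl]
      module
    rw [e, ← S.An_refl S.a0_R0, An, An]
    refine Finset.sum_congr rfl fun w hw => ?_
    rw [ex_add, S.ex_period hμ (S.mem_W0F.1 hw), mul_one]
  | succ j =>
    have : S.kc j.succ = 0 := by simp [kc]
    rw [this, alpha_succ, S.An_refl (S.simple_R0 j)]

lemma shifted (j : Fin (S.n + 1)) (x : V) :
    ⟪x + S.rho, coroot (S.alpha j)⟫ + S.kc j = S.aFun j x + 1 := by
  induction j using Fin.cases with
  | zero => simp only [aFun, inner_add_left, alpha_zero, kconst_zero, kc, if_true, Hc]; ring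
  | succ j => simp [aFun, inner_add_left, kc, rho_coroot]

end Setup

namespace Setup
variable (S : Setup V)

/-! ### The Pieri rule -/

lemma orb_finite (ω : V) : (S.orb ω).Finite := by
  apply (S.W0_finite.image (fun w => w ω)).subset
  rintro x ⟨w, hw, rfl⟩
  exact ⟨w, hw, rfl⟩

/-- orbit as finset -/
def orbF (ω : V) : Finset V := (S.orb_finite ω).toFinset

@[simp] lemma mem_orbF {ω ν : V} : ν ∈ S.orbF ω ↔ ν ∈ S.orb ω := by simp [orbF]

lemma orb_W0 {ω ν : V} (h : ν ∈ S.orb ω) {w : Equiv.Perm V} (hw : w ∈ S.W0) : w ν ∈ S.orb ω := by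
  obtain ⟨v, hv, rfl⟩ := h
  exact ⟨w * v, mul_mem hw hv, rfl⟩

lemma omega_Plat {ω : V} (hω : S.Minuscule ω ∨ ω = S.hs) : ω ∈ S.Plat := by
  rcases hω with h | h
  · exact h.1.1
  · rw [h]; exact S.R0_Plat S.hs_R0

lemma omega_dom {ω : V} (hω : S.Minuscule ω ∨ ω = S.hs) : S.Dom ω := by
  rcases hω with h | h
  · intro j
    rw [← coroot_nonneg_iff (S.simple_ne j)]
    exact h.1.2 _ (S.simple_mem j)
  · rw [h]; exact S.hs_dom

lemma orb_Plat {ω ν : V} (hω : S.Minuscule ω ∨ ω = S.hs) (hν : ν ∈ S.orb ω) : ν ∈ S.Plat := by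
  obtain ⟨w, hw, rfl⟩ := hν
  exact S.Plat_W0 hw (S.omega_Plat hω)

lemma minuscule_abs {ω ν α : V} (hω : S.Minuscule ω) (hν : ν ∈ S.orb ω) (hα : α ∈ S.R0) :
    |⟪ν, coroot α⟫| ≤ 1 := by
  obtain ⟨w, hw, rfl⟩ := hν
  rw [W0_inner' hw, ← W0_coroot (inv_mem hw)]
  have hβ := W0_mem (inv_mem hw) hα
  generalize w⁻¹ α = β at *
  rcases S.pos_or_neg hβ with h | h
  · rw [abs_of_nonneg (hω.1.2 _ h)]; exact hω.2 _ h
  · have h1 := hω.1.2 _ h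
    have h2 := hω.2 _ h
    rw [coroot_neg, inner_neg_right] at h1 h2
    rw [abs_le]; constructor <;> linarith

lemma orb_bound {ω ν α : V} (hω : S.Minuscule ω ∨ ω = S.hs) (hν : ν ∈ S.orb ω)
    (hα : α ∈ S.R0) : |⟪ν, coroot α⟫| ≤ 1 ∨ ν = α ∨ ν = -α := by
  rcases hω with h | h
  · exact Or.inl (S.minuscule_abs h hν hα)
  · obtain ⟨w, hw, rfl⟩ := hν
    rw [h]
    exact S.short_bound (W0_mem hw S.hs_R0) hα (W0_inner hw _ _)

lemma Ncount_minuscule {ω : V} (lam : V) (hω : S.Minuscule ω) : S.Ncount lam ω = 0 := by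
  rw [Ncount]
  have : IsEmpty {j : Fin (S.n + 1) // S.aFun j lam = 0 ∧ S.alpha j ∈ S.orb ω} := by
    constructor
    rintro ⟨j, -, hj⟩
    have h := S.minuscule_abs hω hj (S.alpha_R0 j)
    rw [inner_self_coroot (S.ne_zero (S.alpha_R0 j))] at h
    norm_num at h
  exact Nat.card_of_isEmpty

/-- orbit sum -/
def ms (ω ξ : V) : ℂ := ∑ ν ∈ S.orbF ω, ex ν ξ

lemma ms_inv (ω ξ : V) {w : Equiv.Perm V} (hw : w ∈ S.W0) : S.ms ω (w ξ) = S.ms ω ξ := by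
  rw [ms, ms]
  refine Finset.sum_nbij' (fun ν => w⁻¹ ν) (fun ν => w ν) ?_ ?_ ?_ ?_ ?_
  · intro ν h; simp only [mem_orbF] at h ⊢; exact S.orb_W0 h (inv_mem hw)
  · intro ν h; simp only [mem_orbF] at h ⊢; exact S.orb_W0 h hw
  · intro ν _; simp
  · intro ν _; simp
  · intro ν _; rw [ex, ex, W0_inner' hw]

lemma ms_mul_An (ω x ξ : V) : S.ms ω ξ * S.An x ξ = ∑ ν ∈ S.orbF ω, S.An (x + ν) ξ := by
  simp only [An]
  rw [Finset.sum_comm, Finset.mul_sum]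
  refine Finset.sum_congr rfl fun w hw => ?_
  rw [← S.ms_inv ω ξ (S.mem_W0F.1 hw), ms, Finset.sum_mul]
  refine Finset.sum_congr rfl fun ν _ => ?_
  rw [ex_add]; ring

lemma aFun_add (j : Fin (S.n + 1)) (x ν : V) :
    S.aFun j (x + ν) = S.aFun j x + ⟪ν, coroot (S.alpha j)⟫ := by
  rw [aFun, aFun, inner_add_left]; ring

lemma aFun_int (j : Fin (S.n + 1)) {x : V} (hx : x ∈ S.Plat) : ∃ k : ℤ, S.aFun j x = k := by
  obtain ⟨k, hk⟩ := hx _ (S.alpha_R0 j)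
  rw [aFun, hk, kconst]
  split_ifs
  · exact ⟨k + S.c, by push_cast; rfl⟩
  · exact ⟨k, by simp⟩

lemma term {lam ω μ ν : V} (hlam : lam ∈ S.Pc) (hω : S.Minuscule ω ∨ ω = S.hs)
    (hμ : μ ∈ S.Phatc) (hν : ν ∈ S.orb ω) :
    S.An (lam + S.rho + ν) (S.nd μ) =
      (if lam + ν ∈ S.Pc then S.An (lam + ν + S.rho) (S.nd μ) else 0)
      - (if ∃ j, S.aFun j lam = 0 ∧ ν = -S.alpha j then S.An (lam + S.rho) (S.nd μ) else 0) := by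
  have hP : lam + ν ∈ S.Plat := S.Plat_add hlam.1 (S.orb_Plat hω hν)
  have hl := (S.mem_Pc_iff hlam.1).1 hlam
  have e0 : lam + S.rho + ν = lam + ν + S.rho := by abel
  rw [e0]
  by_cases h2 : ∃ j, S.aFun j lam = 0 ∧ ν = -S.alpha j
  · rw [if_pos h2]
    obtain ⟨j, hj, hn⟩ := h2
    have h3 : S.aFun j (lam + ν) = -2 := by
      rw [aFun_add, hj, hn, inner_neg_left, inner_self_coroot (S.ne_zero (S.alpha_R0 j))]; ring
    have h4 : lam + ν ∉ S.Pc := by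
      rw [S.mem_Pc_iff hP]
      intro hh
      have := hh j
      rw [h3] at this; norm_num at this
    rw [if_neg h4]
    have h5 : reflP (S.alpha j) (S.kc j) (lam + ν + S.rho) = lam + S.rho := by
      rw [reflP_apply, S.shifted j (lam + ν), h3, hn]
      module
    rw [← h5, S.An_aff hμ]; ring
  · rw [if_neg h2]
    by_cases h4 : lam + ν ∈ S.Pc
    · rw [if_pos h4]; ring
    · rw [if_neg h4]
      rw [S.mem_Pc_iff hP] at h4
      push Not at h4 h2
      obtain ⟨j, hj⟩ := h4
      have h3 : S.aFun j (lam + ν) = -1 := by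
        obtain ⟨k, hk⟩ := S.aFun_int j hlam.1
        obtain ⟨l, hl'⟩ := S.aFun_int j hP
        have hk0 : (0:ℝ) ≤ k := hk ▸ hl j
        have hl0 : (l:ℝ) < 0 := hl' ▸ hj
        have hk0' : 0 ≤ k := by exact_mod_cast hk0
        have hl0' : l < 0 := by exact_mod_cast hl0
        have hadd := S.aFun_add j lam ν
        have hna := inner_self_coroot (S.ne_zero (S.alpha_R0 j))
        have hgoal : l = -1 := by
          rcases S.orb_bound hω hν (S.alpha_R0 j) with hb | hb | hb
          · have h5 := (abs_le.1 hb).1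
            have : (k:ℝ) - 1 ≤ l := by rw [← hl', hadd, hk]; linarith
            have : k - 1 ≤ l := by exact_mod_cast this
            omega
          · rw [hb, hna] at hadd
            rw [hb, hadd] at hj
            rw [hk] at hj
            linarith
          · have hk1 : k ≠ 0 := by
              rintro rfl
              exact h2 j (by rw [hk]; simp) hb
            have : (l:ℝ) = k - 2 := by
              rw [← hl', hadd, hk, hb, inner_neg_left, hna]; ring
            have : l = k - 2 := by exact_mod_cast this
            omega
        rw [hl', hgoal]; simp
      have h5 : reflP (S.alpha j) (S.kc j) (lam + ν + S.rho) = lam + ν + S.rho := by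
        rw [reflP_apply, S.shifted j (lam + ν), h3]
        simp
      have h6 := S.An_aff hμ j (lam + ν + S.rho)
      rw [h5] at h6
      rw [S.An_zero_of_neg h6, sub_zero]

lemma count {lam ω : V} :
    ((S.orbF ω).filter fun ν => ∃ j, S.aFun j lam = 0 ∧ ν = -S.alpha j).card = S.Ncount lam ω := by
  have hneg : ∀ j, -S.alpha j ∈ S.orb ω ↔ S.alpha j ∈ S.orb ω := by
    intro j
    have hn := S.ne_zero (S.alpha_R0 j)
    have hw := S.refl_W0 (S.alpha_R0 j)
    constructor
    · intro h
      have := S.orb_W0 h hw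
      rwa [W0_neg hw, reflP_self hn, neg_neg] at this
    · intro h
      have := S.orb_W0 h hw
      rwa [reflP_self hn] at this
  rw [Ncount, Nat.card_eq_fintype_card, Fintype.card_subtype]
  symm
  refine Finset.card_bij (fun j _ => -S.alpha j) ?_ ?_ ?_
  · intro j hj
    simp only [Finset.mem_filter, Finset.mem_univ, true_and, mem_orbF] at hj ⊢
    exact ⟨(hneg j).2 hj.2, j, hj.1, rfl⟩
  · intro i _ j _ h
    exact S.alpha_inj (neg_injective h)
  · intro ν hν
    simp only [Finset.mem_filter, mem_orbF] at hν
    obtain ⟨h, j, hj, rfl⟩ := hν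
    exact ⟨j, by simp [hj, (hneg j).1 h], rfl⟩

lemma pieri_An {lam ω μ : V} (hlam : lam ∈ S.Pc) (hω : S.Minuscule ω ∨ ω = S.hs)
    (hμ : μ ∈ S.Phatc) :
    S.ms ω (S.nd μ) * S.An (lam + S.rho) (S.nd μ) =
      ∑ ν ∈ (S.orbF ω).filter (fun ν => lam + ν ∈ S.Pc), S.An (lam + ν + S.rho) (S.nd μ)
      - S.Ncount lam ω * S.An (lam + S.rho) (S.nd μ) := by
  rw [ms_mul_An, Finset.sum_congr rfl fun ν hν => S.term hlam hω hμ (S.mem_orbF.1 hν),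
    Finset.sum_sub_distrib, ← Finset.sum_filter, ← Finset.sum_filter, Finset.sum_const, S.count,
    nsmul_eq_mul]

lemma zero_Pc : (0 : V) ∈ S.Pc := by
  have h0 : (0 : V) ∈ S.Plat := fun α _ => ⟨0, by simp⟩
  refine ⟨h0, fun α _ => ?_⟩
  rw [inner_zero_left]
  have := S.c_gt
  exact ⟨le_rfl, by exact_mod_cast (by omega : (0:ℤ) ≤ S.c)⟩

lemma omega_Pc {ω : V} (hω : S.Minuscule ω ∨ ω = S.hs) : ω ∈ S.Pc := by
  rw [S.mem_Pc_iff (S.omega_Plat hω)]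
  intro j
  induction j using Fin.cases with
  | succ j =>
    simp only [aFun, alpha_succ, kconst_succ, add_zero]
    rw [coroot_nonneg_iff (S.simple_ne j)]
    exact S.omega_dom hω j
  | zero =>
    simp only [aFun, alpha_zero, kconst_zero]
    have hc : (2:ℝ) ≤ S.c := by exact_mod_cast S.c_gt
    have h2 := inner_self_coroot (S.ne_zero S.a0_R0)
    rcases S.orb_bound hω (⟨1, one_mem _, rfl⟩ : ω ∈ S.orb ω) S.a0_R0 with hb | hb | hb
    · linarith [(abs_le.1 hb).1]
    · rw [hb]; linarith
    · rw [hb, inner_neg_left]; linarith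

lemma pieri_zero {ω μ : V} (hω : S.Minuscule ω ∨ ω = S.hs) (hμ : μ ∈ S.Phatc) :
    S.An (ω + S.rho) (S.nd μ) = (S.ms ω (S.nd μ) + S.Ncount 0 ω) * S.weylDenom (S.nd μ) := by
  have h := S.pieri_An S.zero_Pc hω hμ
  have hf : (S.orbF ω).filter (fun ν => 0 + ν ∈ S.Pc) = {ω} := by
    ext ν
    simp only [Finset.mem_filter, mem_orbF, zero_add, Finset.mem_singleton]
    constructor
    · rintro ⟨⟨w, hw, rfl⟩, hp⟩
      apply S.dom_unique (S.omega_dom hω) hw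
      intro j
      have := (S.mem_Pc_iff hp.1).1 hp j.succ
      simp only [aFun, alpha_succ, kconst_succ, add_zero] at this
      rwa [coroot_nonneg_iff (S.simple_ne j)] at this
    · rintro rfl
      exact ⟨⟨1, one_mem _, rfl⟩, S.omega_Pc hω⟩
  rw [hf, Finset.sum_singleton, zero_add, zero_add, denominator] at h
  linear_combination -h

end Setup


/-- Pieri rule in the fusion ring: for `λ ∈ P_c`, `ω ∈ P⁺` minuscule or
quasi-minuscule, and a node `ξ = ξ_μ(0) = (2π/(h+c))(ρ̂+μ)` with `μ ∈ P̂_c`,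
`χ_ω(ξ)χ_λ(ξ) = (N_{0,ω} − N_{λ,ω})χ_λ(ξ) + ∑_{ν∈W₀ω, λ+ν∈P_c} χ_{λ+ν}(ξ)`; in
particular `N_{λ,ω} = 0` whenever `ω` is minuscule. -/
theorem statement19 (S : Setup V) (ht0 : ∀ α ∈ S.R0, S.t α = 0)
    (lam ω μ : V) (hlam : lam ∈ S.Pc) (hω : S.Minuscule ω ∨ ω = S.hs)
    (hμ : μ ∈ S.Phatc) :
    (∀ ξ : V,
      ξ = (2 * Real.pi / ((1 - ⟪S.rho, coroot S.a0⟫) + (S.c : ℝ))) • (S.rhoHat + μ) →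
      S.chiW ω ξ * S.chiW lam ξ
        = ((S.Ncount 0 ω : ℂ) - (S.Ncount lam ω : ℂ)) * S.chiW lam ξ
          + ∑ᶠ ν ∈ {ν : V | ν ∈ S.orb ω ∧ lam + ν ∈ S.Pc}, S.chiW (lam + ν) ξ) ∧
    (S.Minuscule ω → S.Ncount lam ω = 0) := by
  refine ⟨?_, S.Ncount_minuscule lam⟩
  rintro ξ rfl
  show S.chiW ω (S.nd μ) * S.chiW lam (S.nd μ) = _ * S.chiW lam (S.nd μ)
    + ∑ᶠ ν ∈ {ν : V | ν ∈ S.orb ω ∧ lam + ν ∈ S.Pc}, S.chiW (lam + ν) (S.nd μ)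
  have hset : {ν : V | ν ∈ S.orb ω ∧ lam + ν ∈ S.Pc}
      = (((S.orbF ω).filter fun ν => lam + ν ∈ S.Pc : Finset V) : Set V) := by
    ext ν; simp
  rw [hset, finsum_mem_coe_finset]
  simp only [Setup.chiW_eq]
  by_cases hd : S.weylDenom (S.nd μ) = 0
  · simp [hd]
  have h1 := S.pieri_An hlam hω hμ
  rw [S.pieri_zero hω hμ, ← Finset.mul_sum]
  field_simp
  linear_combination h1

end AffinePieri
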